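/- arXiv:1702.02129 — 3 statements merged into one kernel-verified Lean document; each statement's English description precedes it below -/
import Mathlib

section
/- Consider the equation u_t = Δu + b(x,u,Du) − c(x)|u|^{σ−1}u log^ν(1+|u|) in ℝ₊^{n+1}, where |b(x,ζ,ξ)| ≤ b₀ (1+|x|)^k |ζ|^μ |ξ|^α with b₀ > 0 and c(x) ≥ c₀ (1+|x|)^l with c₀ > 0 for all x ∈ ℝⁿ, ζ ∈ ℝ∖{0}, ξ ∈ ℝⁿ, where α > 0 and σ = max{1, α + μ}. Suppose min{l − k + α, l + 2} ≥ 0 and that ν > 2 if α + μ < 1, ν > max{2, α} if α + μ = 1, and ν > α if α + μ > 1. Then every classical solution of the equation stabilizes to zero uniformly on every compact subset K of ℝⁿ as t → ∞, i.e. lim_{t→∞} sup_{x∈K} |u(x,t)| = 0. -/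
open Set Filter MeasureTheory Metric

noncomputable section

/-- `n`-dimensional Euclidean space. -/
abbrev Eucl (n : ℕ) := EuclideanSpace ℝ (Fin n)

/-- The absorption profile `v ↦ v ^ σ * log (1 + v) ^ ν`. -/
def absorption (σ ν v : ℝ) : ℝ := v ^ σ * Real.log (1 + v) ^ ν

lemma absorption_pos {σ ν v : ℝ} (hv : 0 < v) : 0 < absorption σ ν v :=
  mul_pos (Real.rpow_pos_of_pos hv _) (Real.rpow_pos_of_pos (Real.log_pos (by linarith)) _)

lemma absorption_mono {σ ν v w : ℝ} (hσ : 0 ≤ σ) (hν : 0 ≤ ν) (hv : 0 < v) (hvw : v ≤ w) :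
    absorption σ ν v ≤ absorption σ ν w := by
  have hlog : 0 ≤ Real.log (1 + v) := Real.log_nonneg (by linarith)
  have hw : 0 < w := hv.trans_le hvw
  unfold absorption
  gcongr

/-- If a power times the absorption profile controls `A` at `v`, it does so at every `w ≥ v`. -/
lemma rpow_mul_le_absorption_of_le {σ ν μ v w A B : ℝ} (hμ : μ ≤ σ) (hν : 0 ≤ ν) (hv : 0 < v)
    (hvw : v ≤ w) (hB : 0 ≤ B) (h : v ^ μ * A ≤ B * absorption σ ν v) :
    w ^ μ * A ≤ B * absorption σ ν w := by
  have hw : 0 < w := hv.trans_le hvw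
  have key : ∀ x : ℝ, 0 < x → absorption σ ν x = x ^ μ * absorption (σ - μ) ν x := by
    intro x hx
    unfold absorption
    rw [← mul_assoc, ← Real.rpow_add hx]
    ring_nf
  have hA : A ≤ B * absorption (σ - μ) ν v := by
    rw [key v hv] at h
    have := Real.rpow_pos_of_pos hv μ
    refine le_of_mul_le_mul_left ?_ this
    linarith
  have hm := absorption_mono (σ := σ - μ) (by linarith) hν hv hvw
  calc w ^ μ * A ≤ w ^ μ * (B * absorption (σ - μ) ν w) := by
        have := Real.rpow_pos_of_pos hw μ
        have := mul_le_mul_of_nonneg_left hm hB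
        gcongr
        linarith
    _ = B * absorption σ ν w := by rw [key w hw]; ring

/-- `log (1 + v) ^ a * v ^ b` is dominated by the absorption profile away from `v = 0`. -/
lemma exists_log_rpow_mul_rpow_le {m a b σ ν : ℝ} (hm : 0 < m)
    (h : (b = σ ∧ a ≤ ν) ∨ b < σ) :
    ∃ M : ℝ, 0 < M ∧ ∀ v : ℝ, 0 < v → m ≤ Real.log (1 + v) →
      Real.log (1 + v) ^ a * v ^ b ≤ M * absorption σ ν v := by
  rcases h with ⟨rfl, ha⟩ | hb
  · refine ⟨m ^ (a - ν), by positivity, fun v hv hL => ?_⟩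
    set L := Real.log (1 + v)
    have hL0 : 0 < L := hm.trans_le hL
    have h1 : L ^ (a - ν) ≤ m ^ (a - ν) := Real.rpow_le_rpow_of_nonpos hm hL (by linarith)
    have h2 : L ^ a = L ^ (a - ν) * L ^ ν := by rw [← Real.rpow_add hL0]; ring_nf
    calc L ^ a * v ^ b = L ^ (a - ν) * (v ^ b * L ^ ν) := by rw [h2]; ring
      _ ≤ m ^ (a - ν) * (v ^ b * L ^ ν) := by gcongr
  · set d := max (a - ν) 1 with hd
    have hd0 : 0 < d := lt_of_lt_of_le one_pos (le_max_right _ _)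
    have had : a - ν - d ≤ 0 := by linarith [le_max_left (a - ν) 1]
    set ε := (σ - b) / d with hε
    have hε0 : 0 < ε := div_pos (by linarith) hd0
    have hδ : 0 < Real.exp m - 1 := by linarith [Real.add_one_lt_exp hm.ne']
    set C := 1 + 1 / (Real.exp m - 1) with hC
    have hC0 : 0 < C := by positivity
    refine ⟨m ^ (a - ν - d) * (C ^ (σ - b) * (1 / ε) ^ d), by positivity, fun v hv hL => ?_⟩
    have hv1 : 1 + v ≤ C * v := by
      have : Real.exp m ≤ 1 + v := by
        rwa [← Real.le_log_iff_exp_le (by linarith)]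
      rw [hC, add_mul, one_mul, one_div_mul_eq_div, add_comm]
      gcongr
      rw [le_div_iff₀ hδ]
      linarith
    have hlog : Real.log (1 + v) ≤ (1 + v) ^ ε / ε :=
      Real.log_le_rpow_div (by linarith) hε0
    set L := Real.log (1 + v)
    have hL0 : 0 < L := hm.trans_le hL
    have h1 : L ^ (a - ν - d) ≤ m ^ (a - ν - d) := Real.rpow_le_rpow_of_nonpos hm hL had
    have h2 : L ^ a = L ^ (a - ν - d) * L ^ d * L ^ ν := by
      rw [← Real.rpow_add hL0, ← Real.rpow_add hL0]; ring_nf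
    have h3 : L ^ d ≤ C ^ (σ - b) * (1 / ε) ^ d * v ^ (σ - b) := by
      calc L ^ d ≤ ((1 + v) ^ ε * (1 / ε)) ^ d := by
            rw [← div_eq_mul_one_div]
            gcongr
        _ = (1 + v) ^ (σ - b) * (1 / ε) ^ d := by
            rw [Real.mul_rpow (by positivity) (by positivity), ← Real.rpow_mul (by positivity),
              hε, div_mul_cancel₀ _ hd0.ne']
        _ ≤ (C * v) ^ (σ - b) * (1 / ε) ^ d := by
            gcongr
        _ = _ := by rw [Real.mul_rpow hC0.le hv.le]; ring
    have h4 : v ^ σ = v ^ (σ - b) * v ^ b := by rw [← Real.rpow_add hv]; ring_nf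
    calc L ^ a * v ^ b = L ^ (a - ν - d) * L ^ d * (v ^ b * L ^ ν) := by rw [h2]; ring
      _ ≤ m ^ (a - ν - d) * (C ^ (σ - b) * (1 / ε) ^ d * v ^ (σ - b)) * (v ^ b * L ^ ν) := by
          gcongr
      _ = _ := by unfold absorption; rw [h4]; ring

/-- The admissible exponents `ν` leave room for a blow-up rate of the barrier. -/
lemma exists_one_lt_mul_le {α μ ν : ℝ} (hα : 0 < α)
    (hν₁ : α + μ < 1 → 2 < ν) (hν₂ : α + μ = 1 → max 2 α < ν) (hν₃ : 1 < α + μ → α < ν) :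
    ∃ q : ℝ, 1 < q ∧ (α + μ ≤ 1 → 2 * q ≤ ν) ∧ (1 ≤ α + μ → q * α ≤ ν) := by
  rcases lt_trichotomy (α + μ) 1 with h | h | h
  · refine ⟨ν / 2, by linarith [hν₁ h], fun _ => by linarith, fun h' => by linarith⟩
  · have h2 := hν₂ h
    rw [max_lt_iff] at h2
    refine ⟨min (ν / 2) (ν / α), lt_min (by linarith) ((one_lt_div hα).2 h2.2), fun _ => ?_,
      fun _ => ?_⟩
    · linarith [min_le_left (ν / 2) (ν / α)]
    · exact (le_div_iff₀ hα).1 (min_le_right _ _)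
  · exact ⟨ν / α, (one_lt_div hα).2 (hν₃ h), fun h' => by linarith,
      fun _ => (div_mul_cancel₀ _ hα.ne').le⟩

/-- A one-dimensional profile on `(0, 1]`, equal to `δ` at `1` and blowing up at `0`, whose
derivatives are controlled by the absorption profile. -/
lemma exists_barrier {α μ σ ν δ : ℝ} (hα : 0 < α) (hσ : σ = max 1 (α + μ))
    (hν₁ : α + μ < 1 → 2 < ν) (hν₂ : α + μ = 1 → max 2 α < ν) (hν₃ : 1 < α + μ → α < ν)
    (hδ : 0 < δ) :
    ∃ (G G₁ G₂ : ℝ → ℝ) (M : ℝ), 0 < M ∧ G 1 = δ ∧ Tendsto G (nhdsWithin 0 (Ioi 0)) atTop ∧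
      (∀ z, 0 < z → HasDerivAt G (G₁ z) z) ∧ (∀ z, 0 < z → HasDerivAt G₁ (G₂ z) z) ∧
      ∀ z, 0 < z → z ≤ 1 → 0 < G z ∧ |G₁ z| ≤ M * absorption σ ν (G z) ∧
        |G₂ z| ≤ M * absorption σ ν (G z) ∧
        G z ^ μ * |G₁ z| ^ α ≤ M * absorption σ ν (G z) := by
  obtain ⟨q, hq, hq₁, hq₂⟩ := exists_one_lt_mul_le hα hν₁ hν₂ hν₃
  set m := Real.log (1 + δ) with hm
  have hm0 : 0 < m := Real.log_pos (by linarith)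
  obtain ⟨M₁, hM₁, hb₁⟩ := exists_log_rpow_mul_rpow_le (m := m) (a := 2 * q) (b := 1) (σ := σ)
    (ν := ν) hm0 (by
      rcases le_or_gt (α + μ) 1 with h | h
      · exact Or.inl ⟨by rw [hσ, max_eq_left h], hq₁ h⟩
      · exact Or.inr (by rw [hσ]; exact lt_max_of_lt_right h))
  obtain ⟨M₂, hM₂, hb₂⟩ := exists_log_rpow_mul_rpow_le (m := m) (a := q * α) (b := α + μ) (σ := σ)
    (ν := ν) hm0 (by
      rcases le_or_gt 1 (α + μ) with h | h
      · exact Or.inl ⟨by rw [hσ, max_eq_right h], hq₂ h⟩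
      · exact Or.inr (by rw [hσ]; exact lt_max_of_lt_left h))
  set p := 1 / (q - 1) with hp
  have hp0 : 0 < p := one_div_pos.2 (by linarith)
  have hpq : -p * q = -p - 1 := by
    have : q - 1 ≠ 0 := by linarith
    rw [hp]; field_simp; ring
  set C := 1 + 1 / δ with hC
  have hC0 : 0 < C := by positivity
  set A := m * p * (p + 2) + (m * p) ^ 2 with hA
  have hA0 : 0 < A := by positivity
  set M := A * C * m ^ (-(2 * q)) * M₁ + (m * p * C) ^ α * m ^ (-(q * α)) * M₂ with hM
  refine ⟨fun z => Real.exp (m * z ^ (-p)) - 1,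
    fun z => -(m * p) * z ^ (-p - 1) * Real.exp (m * z ^ (-p)),
    fun z => (m * p * (p + 1) * z ^ (-p - 2) + (m * p * z ^ (-p - 1)) ^ 2) *
      Real.exp (m * z ^ (-p)), M, by positivity, ?_, ?_, ?_, ?_, ?_⟩
  · simp [hm, Real.exp_log (show 0 < 1 + δ by linarith)]
  · refine tendsto_atTop_add_const_right _ _ (Real.tendsto_exp_atTop.comp ?_)
    exact (tendsto_rpow_neg_nhdsGT_zero (by linarith)).const_mul_atTop hm0
  · intro z hz
    have h := (((Real.hasDerivAt_rpow_const (p := -p) (Or.inl hz.ne')).const_mul m).exp).sub_const 1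
    exact h.congr_deriv (by ring)
  · intro z hz
    have h := ((Real.hasDerivAt_rpow_const (p := -p) (Or.inl hz.ne')).const_mul m).exp
    have h' := (Real.hasDerivAt_rpow_const (p := -p - 1) (Or.inl hz.ne')).const_mul (-(m * p))
    refine (h'.mul h).congr_deriv ?_
    rw [show -p - 1 - 1 = -p - 2 by ring]
    ring
  · intro z hz hz1
    have hzp : 1 ≤ z ^ (-p) := Real.one_le_rpow_of_pos_of_le_one_of_nonpos hz hz1 (by linarith)
    set L := m * z ^ (-p) with hL
    have hmL : m ≤ L := by nlinarith
    have hL0 : 0 < L := hm0.trans_le hmL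
    set v := Real.exp L - 1 with hv
    have hlog : Real.log (1 + v) = L := by simp [hv]
    have hδv : δ ≤ v := by
      have := Real.exp_le_exp.2 hmL
      rw [hm, Real.exp_log (by linarith)] at this
      linarith
    have hv0 : 0 < v := hδ.trans_le hδv
    have hE : Real.exp L ≤ C * v := by
      have h1 : 1 ≤ v / δ := (one_le_div hδ).2 hδv
      have h2 : C * v = v + v / δ := by rw [hC]; ring
      rw [h2]; linarith
    set Y := z ^ (-p - 1) with hY
    have hY1 : 1 ≤ Y := Real.one_le_rpow_of_pos_of_le_one_of_nonpos hz hz1 (by linarith)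
    have hYL : Y = m ^ (-q) * L ^ q := by
      have : z ^ (-p) = m⁻¹ * L := by rw [hL]; field_simp
      rw [hY, ← hpq, Real.rpow_mul hz.le, this, Real.mul_rpow (by positivity) hL0.le,
        Real.inv_rpow hm0.le, Real.rpow_neg hm0.le]
    have hY2 : Y ^ 2 = m ^ (-(2 * q)) * L ^ (2 * q) := by
      rw [hYL, mul_pow, ← Real.rpow_natCast, ← Real.rpow_natCast, ← Real.rpow_mul hm0.le,
        ← Real.rpow_mul hL0.le]
      push_cast
      ring_nf
    have hYα : Y ^ α = m ^ (-(q * α)) * L ^ (q * α) := by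
      rw [hYL, Real.mul_rpow (by positivity) (by positivity), ← Real.rpow_mul hm0.le,
        ← Real.rpow_mul hL0.le]
      ring_nf
    have hZ : z ^ (-p - 2) ≤ Y ^ 2 := by
      rw [hY, ← Real.rpow_natCast, ← Real.rpow_mul hz.le]
      apply Real.rpow_le_rpow_of_exponent_ge hz hz1
      push_cast
      linarith
    have hF := absorption_pos (σ := σ) (ν := ν) hv0
    have hbd₁ := hb₁ v hv0 (by rw [hlog]; exact hmL)
    have hbd₂ := hb₂ v hv0 (by rw [hlog]; exact hmL)
    rw [hlog, Real.rpow_one] at hbd₁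
    rw [hlog] at hbd₂
    have hYY : Y ≤ Y ^ 2 := by nlinarith
    have hmain : A * Y ^ 2 * Real.exp L ≤ M * absorption σ ν v := by
      calc A * Y ^ 2 * Real.exp L ≤ A * Y ^ 2 * (C * v) := by gcongr
        _ = A * C * m ^ (-(2 * q)) * (L ^ (2 * q) * v) := by rw [hY2]; ring
        _ ≤ A * C * m ^ (-(2 * q)) * (M₁ * absorption σ ν v) := by gcongr
        _ ≤ M * absorption σ ν v := by
          rw [← mul_assoc]
          gcongr
          rw [hM]
          exact le_add_of_nonneg_right (by positivity)
    have habs : |-(m * p) * Y * Real.exp L| = m * p * Y * Real.exp L := by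
      rw [neg_mul, neg_mul, abs_neg, abs_of_pos (by positivity)]
    refine ⟨hv0, ?_, ?_, ?_⟩
    · rw [habs]
      refine le_trans ?_ hmain
      have : m * p ≤ A := by
        have : 0 < m * p * (p + 1) + (m * p) ^ 2 := by positivity
        rw [hA]; linarith
      gcongr
    · rw [abs_of_pos (by positivity)]
      refine (mul_le_mul_of_nonneg_right ?_ (Real.exp_pos _).le).trans hmain
      have h1 : m * p * (p + 1) * z ^ (-p - 2) ≤ m * p * (p + 1) * Y ^ 2 := by gcongr
      have h2 : 0 < m * p * Y ^ 2 := by positivity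
      have h3 : A * Y ^ 2 = m * p * (p + 1) * Y ^ 2 + (m * p * Y) ^ 2 + m * p * Y ^ 2 := by
        rw [hA]; ring
      linarith
    · rw [habs]
      calc v ^ μ * (m * p * Y * Real.exp L) ^ α ≤ v ^ μ * (m * p * Y * (C * v)) ^ α := by gcongr
        _ = v ^ μ * ((m * p * C) ^ α * Y ^ α * v ^ α) := by
          rw [show m * p * Y * (C * v) = m * p * C * Y * v by ring,
            Real.mul_rpow (by positivity) hv0.le, Real.mul_rpow (by positivity) (by positivity)]
        _ = (m * p * C) ^ α * m ^ (-(q * α)) * (L ^ (q * α) * v ^ (α + μ)) := by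
          rw [hYα, Real.rpow_add hv0]; ring
        _ ≤ (m * p * C) ^ α * m ^ (-(q * α)) * (M₂ * absorption σ ν v) := by gcongr
        _ ≤ M * absorption σ ν v := by
          rw [← mul_assoc]
          gcongr
          rw [hM]
          exact le_add_of_nonneg_left (by positivity)

/-- The second derivative is nonpositive at a local maximum. -/
lemma IsLocalMax.second_deriv_nonpos {f f' : ℝ → ℝ} {a f'' : ℝ} (hmax : IsLocalMax f a)
    (hf : ∀ᶠ r in nhds a, HasDerivAt f (f' r) r) (hf' : HasDerivAt f' f'' a) : f'' ≤ 0 := by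
  by_contra! hpos
  have hd : deriv f =ᶠ[nhds a] f' := hf.mono fun r hr => hr.deriv
  have hdd : deriv (deriv f) a = f'' := by rw [hd.deriv_eq, hf'.deriv]
  have hmin := isLocalMin_of_deriv_deriv_pos (by rwa [hdd]) hmax.deriv_eq_zero
    hf.self_of_nhds.continuousAt
  have hconst : f =ᶠ[nhds a] fun _ => f a := by
    filter_upwards [hmax, hmin] with r h₁ h₂ using le_antisymm h₁ h₂
  have h0 : deriv f =ᶠ[nhds a] fun _ => 0 := by
    filter_upwards [hconst.eventually_nhds] with r hr
    rw [EventuallyEq.deriv_eq hr, deriv_const]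
  rw [h0.deriv_eq, deriv_const] at hdd
  exact hpos.ne hdd

/-- The derivative is nonnegative at a maximum over a left neighbourhood. -/
lemma HasDerivAt.nonneg_of_eventually_le_left {f : ℝ → ℝ} {a f' : ℝ} (hf : HasDerivAt f f' a)
    (hmax : ∀ᶠ r in nhdsWithin a (Iio a), f r ≤ f a) : 0 ≤ f' := by
  have h : Tendsto (slope f a) (nhdsWithin a (Iio a)) (nhds f') :=
    (hasDerivAt_iff_tendsto_slope.1 hf).mono_left
      (nhdsWithin_mono a (fun r (hr : r < a) => hr.ne))
  refine ge_of_tendsto h ?_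
  filter_upwards [hmax, self_mem_nhdsWithin] with r hr (hra : r < a)
  rw [slope_def_field]
  exact div_nonneg_of_nonpos (by linarith) (by linarith)

section Comparison

variable {n : ℕ}

lemma norm_add_smul_single_sq (x : Eucl n) (i : Fin n) (r : ℝ) :
    ‖x + r • EuclideanSpace.single i (1 : ℝ)‖ ^ 2 = ‖x‖ ^ 2 + 2 * r * x i + r ^ 2 := by
  rw [norm_add_sq_real, inner_smul_right, norm_smul, EuclideanSpace.inner_single_right,
    PiLp.norm_single]
  simp
  ring

/-- The logarithmic spatial weight `log (1 + |x|²)`. -/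
def logWeight (x : Eucl n) : ℝ := Real.log (1 + ‖x‖ ^ 2)

lemma logWeight_nonneg (x : Eucl n) : 0 ≤ logWeight x :=
  Real.log_nonneg (by nlinarith [sq_nonneg ‖x‖])

lemma continuous_logWeight : Continuous (logWeight : Eucl n → ℝ) := by
  unfold logWeight
  refine Continuous.log (by fun_prop) fun x => ?_
  positivity

lemma exp_logWeight (x : Eucl n) : Real.exp (logWeight x) = 1 + ‖x‖ ^ 2 :=
  Real.exp_log (by positivity)

lemma hasDerivAt_logWeight (x : Eucl n) (i : Fin n) (r : ℝ) :
    HasDerivAt (fun s : ℝ => logWeight (x + s • EuclideanSpace.single i (1 : ℝ)))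
      ((2 * x i + 2 * r) / (1 + (‖x‖ ^ 2 + 2 * r * x i + r ^ 2))) r := by
  have hpos : 0 < 1 + (‖x‖ ^ 2 + 2 * r * x i + r ^ 2) := by
    rw [← norm_add_smul_single_sq]; positivity
  unfold logWeight
  simp_rw [norm_add_smul_single_sq]
  have h : HasDerivAt (fun s : ℝ => 1 + (‖x‖ ^ 2 + 2 * s * x i + s ^ 2)) (2 * x i + 2 * r) r := by
    have := (((((hasDerivAt_id r).const_mul 2).mul_const (x i)).const_add (‖x‖ ^ 2)).add
      ((hasDerivAt_id r).pow 2)).const_add 1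
    refine this.congr_deriv ?_
    simp
  exact h.log hpos.ne'

lemma hasDerivAt_logWeight_deriv (x : Eucl n) (i : Fin n) :
    HasDerivAt (fun r : ℝ => (2 * x i + 2 * r) / (1 + (‖x‖ ^ 2 + 2 * r * x i + r ^ 2)))
      (2 / (1 + ‖x‖ ^ 2) - (2 * x i / (1 + ‖x‖ ^ 2)) ^ 2) 0 := by
  have h : HasDerivAt (fun s : ℝ => 1 + (‖x‖ ^ 2 + 2 * s * x i + s ^ 2)) (2 * x i + 2 * 0) 0 := by
    have := (((((hasDerivAt_id (0 : ℝ)).const_mul 2).mul_const (x i)).const_add (‖x‖ ^ 2)).add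
      ((hasDerivAt_id (0 : ℝ)).pow 2)).const_add 1
    refine this.congr_deriv ?_
    simp
  have h2 : HasDerivAt (fun s : ℝ => 2 * x i + 2 * s) 2 0 :=
    (((hasDerivAt_id (0 : ℝ)).const_mul 2).const_add (2 * x i)).congr_deriv (by simp)
  have hne : (1 : ℝ) + ‖x‖ ^ 2 ≠ 0 := by positivity
  refine (h2.div h (by simpa using hne)).congr_deriv ?_
  simp
  field_simp

lemma one_div_one_add_norm_sq_le (x : Eucl n) :
    1 / (1 + ‖x‖ ^ 2) ≤ 2 * (1 + ‖x‖) ^ (-2 : ℝ) := by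
  rw [Real.rpow_neg (by positivity), show (2 : ℝ) = ((2 : ℕ) : ℝ) by norm_num, Real.rpow_natCast,
    ← div_eq_mul_inv, div_le_div_iff₀ (by positivity) (by positivity)]
  push_cast
  nlinarith [sq_nonneg (‖x‖ - 1)]

/-- The gradient of the logarithmic weight decays like `1 / (1 + |x|)`. -/
lemma norm_div_one_add_norm_sq_le (x : Eucl n) :
    2 * ‖x‖ / (1 + ‖x‖ ^ 2) ≤ 4 / (1 + ‖x‖) := by
  rw [div_le_div_iff₀ (by positivity) (by positivity)]
  nlinarith [sq_nonneg (‖x‖ - 1), norm_nonneg x]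

lemma abs_coord_le_norm (x : Eucl n) (i : Fin n) : |x i| ≤ ‖x‖ := by
  simpa using PiLp.norm_apply_le x i

lemma logWeight_deriv_sq_le (x : Eucl n) (i : Fin n) :
    (2 * x i / (1 + ‖x‖ ^ 2)) ^ 2 ≤ 4 / (1 + ‖x‖ ^ 2) := by
  have h : x i ^ 2 ≤ ‖x‖ ^ 2 := sq_le_sq' (neg_le_of_abs_le (abs_coord_le_norm x i))
    (le_of_abs_le (abs_coord_le_norm x i))
  rw [div_pow, div_le_div_iff₀ (by positivity) (by positivity)]
  nlinarith [sq_nonneg ‖x‖, mul_nonneg (sq_nonneg ‖x‖) (sq_nonneg ‖x‖)]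

lemma abs_logWeight_second_deriv_le (x : Eucl n) (i : Fin n) :
    |2 / (1 + ‖x‖ ^ 2) - (2 * x i / (1 + ‖x‖ ^ 2)) ^ 2| ≤ 4 / (1 + ‖x‖ ^ 2) := by
  have h1 := logWeight_deriv_sq_le x i
  have h2 := sq_nonneg (2 * x i / (1 + ‖x‖ ^ 2))
  have h3 : 0 < 2 / (1 + ‖x‖ ^ 2) := by positivity
  have h4 : 4 / (1 + ‖x‖ ^ 2) = 2 * (2 / (1 + ‖x‖ ^ 2)) := by ring
  rw [abs_le]
  constructor <;> linarith

lemma HasDerivAt.of_shift {f : ℝ → ℝ} {f' r : ℝ} (h : HasDerivAt (fun s => f (r + s)) f' 0) :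
    HasDerivAt f f' r := by
  have := HasDerivAt.comp_sub_const (f := fun s => f (r + s)) r r (by simpa using h)
  simpa using this

lemma hasDerivAt_line {E : Type*} [AddCommGroup E] [Module ℝ E] {f : E → ℝ} {x e : E} {r f' : ℝ}
    (h : HasDerivAt (fun s : ℝ => f (x + r • e + s • e)) f' 0) :
    HasDerivAt (fun s : ℝ => f (x + s • e)) f' r := by
  refine HasDerivAt.of_shift (f := fun s : ℝ => f (x + s • e)) ?_
  simpa [add_smul, add_assoc] using h

/-- At a spatial maximum of `u - G (h - ε log (1 + |x|²))` the gradient of `u` equals that of the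
barrier and the second derivatives are controlled. -/
lemma spatial_touching {u : Eucl n → ℝ} {du : Eucl n → Eucl n} {x : Eucl n} {i : Fin n}
    {d2 h ε : ℝ} {G G₁ G₂ : ℝ → ℝ}
    (hdu : ∀ y : Eucl n, HasDerivAt
      (fun s : ℝ => u (y + s • EuclideanSpace.single i (1 : ℝ))) (du y i) 0)
    (hd2 : HasDerivAt (fun s : ℝ => du (x + s • EuclideanSpace.single i (1 : ℝ)) i) d2 0)
    (hG : ∀ z, 0 < z → HasDerivAt G (G₁ z) z) (hG₁ : ∀ z, 0 < z → HasDerivAt G₁ (G₂ z) z)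
    (hz : 0 < h - ε * logWeight x)
    (hmax : ∀ y : Eucl n, 0 < h - ε * logWeight y →
      u y - G (h - ε * logWeight y) ≤ u x - G (h - ε * logWeight x)) :
    du x i = -(ε * G₁ (h - ε * logWeight x) * (2 / (1 + ‖x‖ ^ 2))) * x i ∧
    d2 ≤ ε ^ 2 * (2 * x i / (1 + ‖x‖ ^ 2)) ^ 2 * G₂ (h - ε * logWeight x) -
      ε * G₁ (h - ε * logWeight x) *
        (2 / (1 + ‖x‖ ^ 2) - (2 * x i / (1 + ‖x‖ ^ 2)) ^ 2) := by
  set e : Eucl n := EuclideanSpace.single i (1 : ℝ) with he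
  set w : ℝ → ℝ := fun r => h - ε * logWeight (x + r • e) with hw
  set w' : ℝ → ℝ := fun r =>
    -(ε * ((2 * x i + 2 * r) / (1 + (‖x‖ ^ 2 + 2 * r * x i + r ^ 2)))) with hw'
  have hwd : ∀ r, HasDerivAt w (w' r) r := fun r =>
    ((hasDerivAt_logWeight x i r).const_mul ε).const_sub h
  have hwd' : HasDerivAt w'
      (-(ε * (2 / (1 + ‖x‖ ^ 2) - (2 * x i / (1 + ‖x‖ ^ 2)) ^ 2))) 0 :=
    ((hasDerivAt_logWeight_deriv x i).const_mul ε).neg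
  have hw0 : w 0 = h - ε * logWeight x := by simp [hw]
  have hw'0 : w' 0 = -(ε * (2 * x i / (1 + ‖x‖ ^ 2))) := by simp [hw']
  have hwpos : ∀ᶠ r in nhds (0 : ℝ), 0 < w r :=
    (hwd 0).continuousAt.eventually (lt_mem_nhds (by rwa [hw0]))
  have hloc : IsLocalMax (fun r => u (x + r • e) - G (w r)) 0 := by
    filter_upwards [hwpos] with r hr
    simpa [hw0] using hmax _ hr
  have hder : ∀ r, 0 < w r → HasDerivAt (fun r => u (x + r • e) - G (w r))
      (du (x + r • e) i - G₁ (w r) * w' r) r := fun r hr =>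
    (hasDerivAt_line (hdu (x + r • e))).sub ((hG _ hr).comp r (hwd r))
  have hw0pos : 0 < w 0 := by rwa [hw0]
  constructor
  · have := hloc.hasDerivAt_eq_zero (hder 0 hw0pos)
    rw [hw0, hw'0] at this
    simp only [zero_smul, add_zero] at this
    rw [sub_eq_zero.1 this]
    ring
  · have h2 := IsLocalMax.second_deriv_nonpos hloc (hwpos.mono hder)
      (hd2.sub (((hG₁ _ hw0pos).comp 0 (hwd 0)).mul hwd'))
    simp only [Function.comp_apply] at h2
    rw [hw0, hw'0] at h2
    linarith

lemma rpow_neg_two_le {x : Eucl n} {l : ℝ} (hl : 0 ≤ l + 2) :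
    (1 + ‖x‖) ^ (-2 : ℝ) ≤ (1 + ‖x‖) ^ l :=
  Real.rpow_le_rpow_of_exponent_le (by linarith [norm_nonneg x]) (by linarith)

/-- A subsolution cannot touch the barrier from above at a parabolic interior point. -/
lemma false_of_touching {b₀ c₀ α μ σ ν k l M ε η t₀ t : ℝ} {x : Eucl n}
    (hb₀ : 0 < b₀) (hα : 0 < α) (hμσ : μ ≤ σ) (hσ : 0 ≤ σ) (hν : 0 ≤ ν) (hc₀ : 0 < c₀)
    (hkl : 0 ≤ l - k + α) (hl : 0 ≤ l + 2)
    {u : Eucl n → ℝ → ℝ} {du : Eucl n → ℝ → Eucl n}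
    {d2u : Eucl n → ℝ → Fin n → Fin n → ℝ} {ut : Eucl n → ℝ → ℝ}
    (hdu : ∀ (x : Eucl n) (t : ℝ), 0 < t → ∀ i,
      HasDerivAt (fun s : ℝ => u (x + s • EuclideanSpace.single i (1 : ℝ)) t) (du x t i) 0)
    (hd2u : ∀ (x : Eucl n) (t : ℝ), 0 < t → ∀ i j,
      HasDerivAt (fun s : ℝ => du (x + s • EuclideanSpace.single j (1 : ℝ)) t i) (d2u x t i j) 0)
    (hut : ∀ (x : Eucl n) (t : ℝ), 0 < t → HasDerivAt (fun τ : ℝ => u x τ) (ut x t) t)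
    (hsub : ∀ (x : Eucl n) (t : ℝ), 0 < t → 0 < u x t →
      ut x t ≤ (∑ i, d2u x t i i) + b₀ * (1 + ‖x‖) ^ k * u x t ^ μ * ‖du x t‖ ^ α
        - c₀ * (1 + ‖x‖) ^ l * absorption σ ν (u x t))
    {G G₁ G₂ : ℝ → ℝ}
    (hG : ∀ z, 0 < z → HasDerivAt G (G₁ z) z) (hG₁ : ∀ z, 0 < z → HasDerivAt G₁ (G₂ z) z)
    (hM : 0 < M) (hε : 0 < ε) (hε1 : ε ≤ 1) (hη : 0 < η) (ht : 0 < t)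
    (hz : 0 < η * (t - t₀) - ε * logWeight x)
    (hGpos : 0 < G (η * (t - t₀) - ε * logWeight x))
    (hG₁M : |G₁ (η * (t - t₀) - ε * logWeight x)| ≤
      M * absorption σ ν (G (η * (t - t₀) - ε * logWeight x)))
    (hG₂M : |G₂ (η * (t - t₀) - ε * logWeight x)| ≤
      M * absorption σ ν (G (η * (t - t₀) - ε * logWeight x)))
    (hGαM : G (η * (t - t₀) - ε * logWeight x) ^ μ * |G₁ (η * (t - t₀) - ε * logWeight x)| ^ α ≤
      M * absorption σ ν (G (η * (t - t₀) - ε * logWeight x)))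
    (hηM : η * M ≤ c₀ / 4 * (1 + ‖x‖) ^ l)
    (hεM : n * (16 * ε * M) ≤ c₀ / 4)
    (hεα : b₀ * (4 * ε) ^ α * M ≤ c₀ / 4)
    (hmax : ∀ (y : Eucl n) (s : ℝ), 0 < s → s ≤ t → 0 < η * (s - t₀) - ε * logWeight y →
      u y s - G (η * (s - t₀) - ε * logWeight y) ≤
        u x t - G (η * (t - t₀) - ε * logWeight x))
    (hlt : G (η * (t - t₀) - ε * logWeight x) < u x t) : False := by
  set z := η * (t - t₀) - ε * logWeight x with hzdef
  have hu : 0 < u x t := hGpos.trans hlt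
  have hspace := fun i => spatial_touching (i := i) (u := fun y => u y t) (du := fun y => du y t)
    (fun y => hdu y t ht i) (hd2u x t ht i i) hG hG₁ hz (fun y hy => hmax y t ht le_rfl hy)
  rw [← hzdef] at hspace
  have hρ : 0 < 1 + ‖x‖ := by positivity
  set F := absorption σ ν (G z) with hF
  set FU := absorption σ ν (u x t) with hFU
  have hFpos : 0 < F := absorption_pos hGpos
  have hFUpos : 0 < FU := absorption_pos hu
  have hFFU : F ≤ FU := absorption_mono hσ hν hGpos hlt.le
  have hρl : 0 < (1 + ‖x‖) ^ l := by positivity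
  -- the time derivative
  have htime : -(η * M * F) ≤ ut x t := by
    have hzt : HasDerivAt (fun s : ℝ => η * (s - t₀) - ε * logWeight x) η t := by
      simpa using (((hasDerivAt_id t).sub_const t₀).const_mul η).sub_const (ε * logWeight x)
    have hd := (hut x t ht).sub (HasDerivAt.comp t (hG z hz) hzt)
    have h0 := HasDerivAt.nonneg_of_eventually_le_left hd (by
      have h1 : ∀ᶠ s in nhdsWithin t (Iio t), 0 < η * (s - t₀) - ε * logWeight x :=
        (hzt.continuousAt.eventually (lt_mem_nhds hz)).filter_mono nhdsWithin_le_nhds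
      have h2 : ∀ᶠ s in nhdsWithin t (Iio t), 0 < s :=
        (lt_mem_nhds ht).filter_mono nhdsWithin_le_nhds
      filter_upwards [h1, h2, self_mem_nhdsWithin] with s hs1 hs2 (hs3 : s < t)
      exact hmax x s hs2 hs3.le hs1)
    have h3 : -(M * F) ≤ G₁ z := neg_le_of_abs_le hG₁M
    nlinarith
  -- the Laplacian
  have hlap : ∑ i, d2u x t i i ≤ c₀ / 4 * (1 + ‖x‖) ^ l * F := by
    have hterm : ∀ i, d2u x t i i ≤ 16 * ε * M * F * (1 + ‖x‖) ^ l := by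
      intro i
      have h1 := (hspace i).2
      have hs1 := logWeight_deriv_sq_le x i
      have hs2 := abs_logWeight_second_deriv_le x i
      set a := (2 * x i / (1 + ‖x‖ ^ 2)) ^ 2 with ha
      have ha0 : 0 ≤ a := sq_nonneg _
      set d := 2 / (1 + ‖x‖ ^ 2) - a
      have hq : 4 / (1 + ‖x‖ ^ 2) ≤ 8 * (1 + ‖x‖) ^ l := by
        have h5 := (one_div_one_add_norm_sq_le x).trans
          (mul_le_mul_of_nonneg_left (rpow_neg_two_le (x := x) hl) zero_le_two)
        have h6 : 4 / (1 + ‖x‖ ^ 2) = 4 * (1 / (1 + ‖x‖ ^ 2)) := by ring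
        linarith
      have hA : ε ^ 2 * a * G₂ z ≤ ε * (8 * (1 + ‖x‖) ^ l) * (M * F) := by
        calc ε ^ 2 * a * G₂ z ≤ ε ^ 2 * a * (M * F) := by
              gcongr
              exact (le_abs_self _).trans hG₂M
          _ ≤ ε * (8 * (1 + ‖x‖) ^ l) * (M * F) := by
              have : ε ^ 2 ≤ ε := by nlinarith
              gcongr
              exact hs1.trans hq
      have hB : -(ε * G₁ z * d) ≤ ε * (8 * (1 + ‖x‖) ^ l) * (M * F) := by
        calc -(ε * G₁ z * d) ≤ |ε * G₁ z * d| := neg_le_abs _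
          _ = ε * |d| * |G₁ z| := by rw [abs_mul, abs_mul, abs_of_pos hε]; ring
          _ ≤ ε * (8 * (1 + ‖x‖) ^ l) * (M * F) := by
              gcongr
              exact hs2.trans hq
      linarith
    calc ∑ i, d2u x t i i ≤ ∑ _i : Fin n, 16 * ε * M * F * (1 + ‖x‖) ^ l :=
          Finset.sum_le_sum fun i _ => hterm i
      _ = n * (16 * ε * M) * ((1 + ‖x‖) ^ l * F) := by
          rw [Finset.sum_const, Finset.card_univ, Fintype.card_fin, nsmul_eq_mul]; ring
      _ ≤ c₀ / 4 * ((1 + ‖x‖) ^ l * F) := by gcongr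
      _ = _ := by ring
  -- the gradient term
  have hgrad : b₀ * (1 + ‖x‖) ^ k * u x t ^ μ * ‖du x t‖ ^ α ≤ c₀ / 4 * (1 + ‖x‖) ^ l * FU := by
    have hdueq : du x t = (-(ε * G₁ z * (2 / (1 + ‖x‖ ^ 2)))) • x := by
      ext i
      simpa using (hspace i).1
    have hnorm : ‖du x t‖ ≤ 4 * ε * |G₁ z| * (1 + ‖x‖)⁻¹ := by
      have h1 := norm_div_one_add_norm_sq_le x
      calc ‖du x t‖ = ε * |G₁ z| * (2 * ‖x‖ / (1 + ‖x‖ ^ 2)) := by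
            rw [hdueq, norm_smul, norm_neg, Real.norm_eq_abs, abs_mul, abs_mul, abs_of_pos hε,
              abs_of_pos (show 0 < 2 / (1 + ‖x‖ ^ 2) by positivity)]
            ring
        _ ≤ ε * |G₁ z| * (4 / (1 + ‖x‖)) := by gcongr
        _ = _ := by ring
    have hpow : ‖du x t‖ ^ α ≤ (4 * ε) ^ α * |G₁ z| ^ α * (1 + ‖x‖) ^ (-α) := by
      calc ‖du x t‖ ^ α ≤ (4 * ε * |G₁ z| * (1 + ‖x‖)⁻¹) ^ α := by gcongr
        _ = _ := by
          rw [Real.mul_rpow (by positivity) (by positivity),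
            Real.mul_rpow (by positivity) (by positivity), Real.inv_rpow hρ.le,
            Real.rpow_neg hρ.le]
    have hkα : (1 + ‖x‖) ^ k * (1 + ‖x‖) ^ (-α) ≤ (1 + ‖x‖) ^ l := by
      rw [← Real.rpow_add hρ]
      exact Real.rpow_le_rpow_of_exponent_le (by linarith [norm_nonneg x]) (by linarith)
    have hUα : u x t ^ μ * |G₁ z| ^ α ≤ M * FU :=
      rpow_mul_le_absorption_of_le hμσ hν hGpos hlt.le hM.le hGαM
    calc b₀ * (1 + ‖x‖) ^ k * u x t ^ μ * ‖du x t‖ ^ α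
        ≤ b₀ * (1 + ‖x‖) ^ k * u x t ^ μ *
          ((4 * ε) ^ α * |G₁ z| ^ α * (1 + ‖x‖) ^ (-α)) := by gcongr
      _ = b₀ * (4 * ε) ^ α * ((1 + ‖x‖) ^ k * (1 + ‖x‖) ^ (-α)) *
          (u x t ^ μ * |G₁ z| ^ α) := by ring
      _ ≤ b₀ * (4 * ε) ^ α * (1 + ‖x‖) ^ l * (M * FU) := by gcongr
      _ = b₀ * (4 * ε) ^ α * M * ((1 + ‖x‖) ^ l * FU) := by ring
      _ ≤ c₀ / 4 * ((1 + ‖x‖) ^ l * FU) := by gcongr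
      _ = _ := by ring
  have hs := hsub x t ht hu
  have h1 : η * M * F ≤ c₀ / 4 * (1 + ‖x‖) ^ l * FU := by gcongr
  have h2 : c₀ / 4 * (1 + ‖x‖) ^ l * F ≤ c₀ / 4 * (1 + ‖x‖) ^ l * FU := by gcongr
  have h3 : 0 < c₀ / 4 * (1 + ‖x‖) ^ l * FU := by positivity
  have h4 : c₀ * (1 + ‖x‖) ^ l * FU = 4 * (c₀ / 4 * (1 + ‖x‖) ^ l * FU) := by ring
  linarith

/-- A function exceeding the barrier at the final time touches it from above at some parabolic
interior point of the truncated cone `ε log (1 + |x|²) < η (t - t₀)`. -/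
lemma exists_touching {u : Eucl n → ℝ → ℝ} {G : ℝ → ℝ} {ε η t₀ t₁ : ℝ} {x₁ : Eucl n}
    (hu_cont : ContinuousOn (fun q : Eucl n × ℝ => u q.1 q.2) (univ ×ˢ Ioi 0))
    (hG : ∀ z, 0 < z → ContinuousAt G z) (hGtop : Tendsto G (nhdsWithin 0 (Ioi 0)) atTop)
    (hε : 0 < ε) (hη : 0 < η) (ht₀ : 0 < t₀) (ht₀₁ : t₀ ≤ t₁)
    (hz : 0 < η * (t₁ - t₀) - ε * logWeight x₁)
    (hlt : G (η * (t₁ - t₀) - ε * logWeight x₁) < u x₁ t₁) :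
    ∃ (x : Eucl n) (t : ℝ), t₀ < t ∧ t ≤ t₁ ∧ 0 < η * (t - t₀) - ε * logWeight x ∧
      G (η * (t - t₀) - ε * logWeight x) < u x t ∧
      ∀ (y : Eucl n) (s : ℝ), 0 < s → s ≤ t → 0 < η * (s - t₀) - ε * logWeight y →
        u y s - G (η * (s - t₀) - ε * logWeight y) ≤
          u x t - G (η * (t - t₀) - ε * logWeight x) := by
  set Z : Eucl n × ℝ → ℝ := fun q => η * (q.2 - t₀) - ε * logWeight q.1 with hZ
  have hZc : Continuous Z := by
    have := (continuous_logWeight (n := n)).comp (continuous_fst (Y := ℝ))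
    exact (by fun_prop : Continuous fun q : Eucl n × ℝ => η * (q.2 - t₀)).sub
      (continuous_const.mul this)
  set S : ℝ → Set (Eucl n × ℝ) := fun c => {q | q.2 ∈ Icc t₀ t₁ ∧ c ≤ Z q} with hS
  have hScompact : ∀ c, 0 ≤ c → IsCompact (S c) := by
    intro c hc
    refine IsCompact.of_isClosed_subset ((isCompact_closedBall (0 : Eucl n)
      (Real.exp (η * (t₁ - t₀) / ε))).prod (isCompact_Icc (a := t₀) (b := t₁))) ?_ ?_
    · exact (isClosed_Icc.preimage continuous_snd).inter (isClosed_le continuous_const hZc)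
    · rintro ⟨y, s⟩ ⟨hs, hcz⟩
      refine ⟨?_, hs⟩
      simp only [hZ] at hcz
      have h1 : logWeight y ≤ η * (t₁ - t₀) / ε := by
        rw [le_div_iff₀ hε]
        have := mul_le_mul_of_nonneg_left (sub_le_sub_right hs.2 t₀) hη.le
        linarith
      have h2 := Real.exp_le_exp.2 h1
      rw [exp_logWeight] at h2
      rw [mem_closedBall, dist_zero_right]
      nlinarith [sq_nonneg (‖y‖ - 1)]
  have hSdom : ∀ c, S c ⊆ univ ×ˢ Ioi 0 := fun c q hq => ⟨mem_univ _, ht₀.trans_le hq.1.1⟩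
  obtain ⟨B, hB⟩ := ((hScompact 0 le_rfl).image_of_continuousOn
    (hu_cont.mono (hSdom 0))).bddAbove
  have hGB : ∀ᶠ z in nhdsWithin (0 : ℝ) (Ioi 0), B < G z := hGtop.eventually_gt_atTop B
  obtain ⟨z₀, hz₀, hGz₀⟩ := (mem_nhdsGT_iff_exists_Ioo_subset).1 hGB
  set c := min (z₀ / 2) (Z (x₁, t₁)) with hc
  have hc0 : 0 < c := lt_min (half_pos hz₀) hz
  have hcz₀ : c < z₀ := (min_le_left _ _).trans_lt (half_lt_self hz₀)
  have hmem : (x₁, t₁) ∈ S c := ⟨⟨ht₀₁, le_rfl⟩, min_le_right _ _⟩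
  have hcont : ContinuousOn (fun q : Eucl n × ℝ => u q.1 q.2 - G (Z q)) (S c) := by
    refine (hu_cont.mono (hSdom c)).sub fun q hq => ?_
    exact ((hG _ (hc0.trans_le hq.2)).comp hZc.continuousAt).continuousWithinAt
  obtain ⟨⟨x, t⟩, hxt, hmax⟩ := (hScompact c hc0.le).exists_isMaxOn ⟨_, hmem⟩ hcont
  have hpos : 0 < u x t - G (Z (x, t)) :=
    (sub_pos.2 hlt).trans_le (hmax hmem)
  have hZxt : 0 < Z (x, t) := hc0.trans_le hxt.2
  have hfwd : ∀ (y : Eucl n) (s : ℝ), 0 < Z (y, s) → t₀ < s := by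
    intro y s hys
    simp only [hZ] at hys
    by_contra! h
    have h1 := mul_nonneg hε.le (logWeight_nonneg y)
    have h2 := mul_nonneg hη.le (sub_nonneg.2 h)
    linarith
  refine ⟨x, t, hfwd x t hZxt, hxt.1.2, hZxt, sub_pos.1 hpos, fun y s _ hst hys => ?_⟩
  have hs : s ∈ Icc t₀ t₁ := ⟨(hfwd y s hys).le, hst.trans hxt.1.2⟩
  by_cases hcase : c ≤ Z (y, s)
  · exact hmax (show (y, s) ∈ S c from ⟨hs, hcase⟩)
  · have h1 : u y s ≤ B :=
      hB ⟨(y, s), ⟨hs, le_of_lt hys⟩, rfl⟩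
    have h2 : B < G (Z (y, s)) := hGz₀ ⟨hys, (not_le.1 hcase).trans hcz₀⟩
    change u y s - G (Z (y, s)) ≤ u x t - G (Z (x, t))
    linarith

/-- Subsolutions are eventually at most any given positive level, uniformly on compact sets. -/
lemma eventually_le_of_subsolution {b₀ c₀ α μ σ ν k l : ℝ}
    (hb₀ : 0 < b₀) (hc₀ : 0 < c₀) (hα : 0 < α) (hσ : σ = max 1 (α + μ))
    (hkl : 0 ≤ l - k + α) (hl : 0 ≤ l + 2)
    (hν₁ : α + μ < 1 → 2 < ν) (hν₂ : α + μ = 1 → max 2 α < ν) (hν₃ : 1 < α + μ → α < ν)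
    {u : Eucl n → ℝ → ℝ} {du : Eucl n → ℝ → Eucl n}
    {d2u : Eucl n → ℝ → Fin n → Fin n → ℝ} {ut : Eucl n → ℝ → ℝ}
    (hdu : ∀ (x : Eucl n) (t : ℝ), 0 < t → ∀ i,
      HasDerivAt (fun s : ℝ => u (x + s • EuclideanSpace.single i (1 : ℝ)) t) (du x t i) 0)
    (hd2u : ∀ (x : Eucl n) (t : ℝ), 0 < t → ∀ i j,
      HasDerivAt (fun s : ℝ => du (x + s • EuclideanSpace.single j (1 : ℝ)) t i) (d2u x t i j) 0)
    (hut : ∀ (x : Eucl n) (t : ℝ), 0 < t → HasDerivAt (fun τ : ℝ => u x τ) (ut x t) t)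
    (hu_cont : ContinuousOn (fun q : Eucl n × ℝ => u q.1 q.2) (univ ×ˢ Ioi 0))
    (hsub : ∀ (x : Eucl n) (t : ℝ), 0 < t → 0 < u x t →
      ut x t ≤ (∑ i, d2u x t i i) + b₀ * (1 + ‖x‖) ^ k * u x t ^ μ * ‖du x t‖ ^ α
        - c₀ * (1 + ‖x‖) ^ l * absorption σ ν (u x t))
    {K : Set (Eucl n)} (hK : IsCompact K) {e : ℝ} (he : 0 < e) :
    ∀ᶠ t in atTop, ∀ x ∈ K, u x t ≤ e := by
  have hν : 0 ≤ ν := by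
    rcases lt_trichotomy (α + μ) 1 with h | h | h
    · linarith [hν₁ h]
    · linarith [hν₂ h, le_max_left 2 α]
    · linarith [hν₃ h]
  have hσ1 : 1 ≤ σ := hσ ▸ le_max_left _ _
  have hμσ : μ ≤ σ := by linarith [hσ ▸ le_max_right 1 (α + μ)]
  obtain ⟨G, G₁, G₂, M, hM, hG1, hGtop, hG, hG₁, hbd⟩ :=
    exists_barrier hα hσ hν₁ hν₂ hν₃ (half_pos he)
  obtain ⟨R, hR⟩ := (hK.image continuous_logWeight).bddAbove
  have hsmall : ∃ ε : ℝ, 0 < ε ∧ ε ≤ 1 ∧ n * (16 * ε * M) ≤ c₀ / 4 ∧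
      b₀ * (4 * ε) ^ α * M ≤ c₀ / 4 ∧ ∀ x ∈ K, 0 < 1 - ε * logWeight x ∧
        G (1 - ε * logWeight x) ≤ e := by
    have hnear : ∀ᶠ z in nhds (1 : ℝ), 0 < z ∧ G z < e :=
      (lt_mem_nhds one_pos).and ((hG 1 one_pos).continuousAt.eventually
        (gt_mem_nhds (by rw [hG1]; exact half_lt_self he)))
    obtain ⟨r, hr, hball⟩ := Metric.eventually_nhds_iff.1 hnear
    have t1 : Tendsto (fun ε : ℝ => n * (16 * ε * M)) (nhdsWithin 0 (Ioi 0)) (nhds 0) := by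
      have : Continuous fun ε : ℝ => n * (16 * ε * M) := by fun_prop
      simpa using (this.tendsto 0).mono_left nhdsWithin_le_nhds
    have t2 : Tendsto (fun ε : ℝ => b₀ * (4 * ε) ^ α * M) (nhdsWithin 0 (Ioi 0)) (nhds 0) := by
      have : Continuous fun ε : ℝ => b₀ * (4 * ε) ^ α * M := by
        have := Real.continuous_rpow_const (q := α) hα.le
        fun_prop
      simpa [hα.ne'] using (this.tendsto 0).mono_left nhdsWithin_le_nhds
    have t3 : Tendsto (fun ε : ℝ => ε * R) (nhdsWithin 0 (Ioi 0)) (nhds 0) := by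
      have : Continuous fun ε : ℝ => ε * R := by fun_prop
      simpa using (this.tendsto 0).mono_left nhdsWithin_le_nhds
    have t4 : ∀ᶠ ε : ℝ in nhdsWithin 0 (Ioi 0), ε < 1 :=
      (gt_mem_nhds one_pos).filter_mono nhdsWithin_le_nhds
    have hc4 : 0 < c₀ / 4 := by positivity
    obtain ⟨ε, h0, h1, h2, h3, h4⟩ := ((eventually_mem_nhdsWithin (a := (0 : ℝ)) (s := Ioi 0)).and
      (t4.and ((t1.eventually (gt_mem_nhds hc4)).and ((t2.eventually (gt_mem_nhds hc4)).and
        (t3.eventually (gt_mem_nhds hr)))))).exists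
    refine ⟨ε, h0, h1.le, h2.le, h3.le, fun x hx => ?_⟩
    have hs0 := mul_nonneg (le_of_lt h0) (logWeight_nonneg x)
    have hs1 : ε * logWeight x < r :=
      (mul_le_mul_of_nonneg_left (hR (mem_image_of_mem _ hx)) (le_of_lt h0)).trans_lt h4
    have := hball (y := 1 - ε * logWeight x) (by
      rw [Real.dist_eq, sub_sub_cancel_left, abs_neg, abs_of_nonneg hs0]; exact hs1)
    exact ⟨this.1, this.2.le⟩
  obtain ⟨ε, hε, hε1, hεM, hεα, hεK⟩ := hsmall
  set η := c₀ / (8 * M * Real.exp (1 / ε)) with hη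
  have hη0 : 0 < η := by positivity
  filter_upwards [eventually_gt_atTop (1 / η)] with t₁ ht₁ x₁ hx₁
  obtain ⟨hz₁, hGe⟩ := hεK x₁ hx₁
  by_contra! hcon
  set t₀ := t₁ - 1 / η with ht₀
  have hone : η * (t₁ - t₀) = 1 := by
    rw [ht₀, sub_sub_cancel, mul_one_div_cancel hη0.ne']
  have ht₀0 : 0 < t₀ := sub_pos.2 ht₁
  obtain ⟨x, t, ht₀t, htt₁, hz, hlt, hmax⟩ := exists_touching (t₀ := t₀) (t₁ := t₁) (x₁ := x₁)
    (ε := ε) (η := η) hu_cont (fun z hz => (hG z hz).continuousAt) hGtop hε hη0 ht₀0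
    (by rw [ht₀]; linarith [one_div_pos.2 hη0]) (by rwa [hone])
    (by rw [hone]; exact hGe.trans_lt hcon)
  have hle1 : η * (t - t₀) ≤ 1 := by
    rw [← hone]
    gcongr
  have hz1 : η * (t - t₀) - ε * logWeight x ≤ 1 := by
    linarith [mul_nonneg hε.le (logWeight_nonneg x)]
  obtain ⟨hp, hp₁, hp₂, hp₃⟩ := hbd _ hz hz1
  have hηM : η * M ≤ c₀ / 4 * (1 + ‖x‖) ^ l := by
    have h1 : logWeight x ≤ 1 / ε := by
      rw [le_div_iff₀ hε]
      linarith
    have h2 := Real.exp_le_exp.2 h1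
    rw [exp_logWeight] at h2
    have h3 : 1 / Real.exp (1 / ε) ≤ 2 * (1 + ‖x‖) ^ l :=
      (one_div_le_one_div_of_le (by positivity) h2).trans ((one_div_one_add_norm_sq_le x).trans
        (mul_le_mul_of_nonneg_left (rpow_neg_two_le hl) zero_le_two))
    have h4 : η * M = c₀ / 8 * (1 / Real.exp (1 / ε)) := by
      rw [hη]; field_simp
    rw [h4]
    nlinarith
  exact false_of_touching hb₀ hα hμσ (by linarith) hν hc₀ hkl hl hdu hd2u hut hsub hG hG₁ hM hε
    hε1 hη0 (ht₀0.trans ht₀t) hz hp hp₁ hp₂ hp₃ hηM hεM hεα hmax hlt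

end Comparison

/-- **Example 2.3.** For `u_t = Δu + b(x,u,Du) − c(x)|u|^{σ−1}u log^ν(1+|u|)` in
`ℝⁿ × (0,∞)` with `|b(x,ζ,ξ)| ≤ b₀(1+|x|)^k |ζ|^μ |ξ|^α`, `c(x) ≥ c₀(1+|x|)^l`,
critical exponent `σ = max{1, α+μ}`, if `min{l−k+α, l+2} ≥ 0` and `ν` satisfies the
case condition (3.1.3), then every classical solution stabilizes to zero uniformly
on every compact subset of `ℝⁿ` as `t → ∞`. -/
theorem example_2_3_stabilization
    (n : ℕ) (hn : 1 ≤ n)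
    (b : Eucl n → ℝ → Eucl n → ℝ) (c : Eucl n → ℝ)
    (b₀ c₀ α μ σ ν k l : ℝ)
    (hb₀ : 0 < b₀) (hc₀ : 0 < c₀) (hα : 0 < α)
    (hb : ∀ (x : Eucl n) (ζ : ℝ) (ξ : Eucl n), ζ ≠ 0 →
      |b x ζ ξ| ≤ b₀ * (1 + ‖x‖) ^ k * |ζ| ^ μ * ‖ξ‖ ^ α)
    (hc : ∀ x : Eucl n, c₀ * (1 + ‖x‖) ^ l ≤ c x)
    (hσ : σ = max 1 (α + μ))
    (hmin : 0 ≤ min (l - k + α) (l + 2))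
    (hν₁ : α + μ < 1 → 2 < ν)
    (hν₂ : α + μ = 1 → max 2 α < ν)
    (hν₃ : 1 < α + μ → α < ν)
    -- `u` is a classical solution
    (u : Eucl n → ℝ → ℝ) (du : Eucl n → ℝ → Eucl n)
    (d2u : Eucl n → ℝ → Fin n → Fin n → ℝ) (ut : Eucl n → ℝ → ℝ)
    (hdu : ∀ (x : Eucl n) (t : ℝ), 0 < t → ∀ i,
      HasDerivAt (fun s : ℝ => u (x + s • EuclideanSpace.single i (1 : ℝ)) t) (du x t i) 0)
    (hd2u : ∀ (x : Eucl n) (t : ℝ), 0 < t → ∀ i j,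
      HasDerivAt (fun s : ℝ => du (x + s • EuclideanSpace.single j (1 : ℝ)) t i) (d2u x t i j) 0)
    (hut : ∀ (x : Eucl n) (t : ℝ), 0 < t → HasDerivAt (fun τ : ℝ => u x τ) (ut x t) t)
    (hu_cont : ContinuousOn (fun q : Eucl n × ℝ => u q.1 q.2) (univ ×ˢ Ioi 0))
    (hdu_cont : ∀ i, ContinuousOn (fun q : Eucl n × ℝ => du q.1 q.2 i) (univ ×ˢ Ioi 0))
    (hd2u_cont : ∀ i j, ContinuousOn (fun q : Eucl n × ℝ => d2u q.1 q.2 i j) (univ ×ˢ Ioi 0))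
    (hut_cont : ContinuousOn (fun q : Eucl n × ℝ => ut q.1 q.2) (univ ×ˢ Ioi 0))
    -- the equation `u_t = Δu + b(x,u,Du) − c(x)|u|^{σ−1}u log^ν(1+|u|)`
    (heq : ∀ (x : Eucl n) (t : ℝ), 0 < t →
      ut x t = (∑ i, d2u x t i i) + b x (u x t) (du x t)
        - c x * |u x t| ^ (σ - 1) * u x t * Real.log (1 + |u x t|) ^ ν) :
    ∀ K : Set (Eucl n), IsCompact K →
      Tendsto (fun t : ℝ => sSup ((fun x => |u x t|) '' K)) atTop (nhds 0) := by
  intro K hK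
  have hkl : 0 ≤ l - k + α := hmin.trans (min_le_left _ _)
  have hl : 0 ≤ l + 2 := hmin.trans (min_le_right _ _)
  have habsorb : ∀ (x : Eucl n) (v : ℝ), 0 < v →
      c₀ * (1 + ‖x‖) ^ l * absorption σ ν v ≤
        c x * v ^ (σ - 1) * v * Real.log (1 + v) ^ ν := by
    intro x v hv
    have h1 : c x * v ^ (σ - 1) * v * Real.log (1 + v) ^ ν = c x * absorption σ ν v := by
      rw [absorption, mul_assoc (c x), ← Real.rpow_add_one hv.ne']
      ring_nf
    rw [h1]
    exact mul_le_mul_of_nonneg_right (hc x) (absorption_pos hv).le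
  have hupper : ∀ e : ℝ, 0 < e → ∀ᶠ t in atTop, ∀ x ∈ K, u x t ≤ e := fun e he =>
    eventually_le_of_subsolution hb₀ hc₀ hα hσ hkl hl hν₁ hν₂ hν₃ hdu hd2u hut hu_cont
      (fun x t ht hpos => by
        have h1 := le_of_abs_le (hb x (u x t) (du x t) hpos.ne')
        have h2 := habsorb x (u x t) hpos
        have h3 := heq x t ht
        rw [abs_of_pos hpos] at h1 h3
        linarith) hK he
  have hlower : ∀ e : ℝ, 0 < e → ∀ᶠ t in atTop, ∀ x ∈ K, -u x t ≤ e := fun e he =>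
    eventually_le_of_subsolution (u := fun x t => -u x t) (du := fun x t => -du x t)
      (d2u := fun x t i j => -d2u x t i j) (ut := fun x t => -ut x t)
      hb₀ hc₀ hα hσ hkl hl hν₁ hν₂ hν₃
      (fun x t ht i => (hdu x t ht i).neg)
      (fun x t ht i j => (hd2u x t ht i j).neg)
      (fun x t ht => (hut x t ht).neg) hu_cont.neg
      (fun x t ht hpos => by
        have hneg : u x t < 0 := neg_pos.1 hpos
        have h1 := neg_le_of_abs_le (hb x (u x t) (du x t) hneg.ne)
        have h2 := habsorb x (-u x t) hpos
        have h3 := heq x t ht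
        rw [abs_of_neg hneg] at h1 h3
        rw [norm_neg, Finset.sum_neg_distrib]
        linarith) hK he
  rw [Metric.tendsto_nhds]
  intro e he
  filter_upwards [hupper (e / 2) (half_pos he), hlower (e / 2) (half_pos he)] with t h₁ h₂
  have hle : sSup ((fun x => |u x t|) '' K) ≤ e / 2 := by
    refine Real.sSup_le ?_ (half_pos he).le
    rintro _ ⟨x, hx, rfl⟩
    exact abs_le.2 ⟨by linarith [h₂ x hx], h₁ x hx⟩
  have hnn : 0 ≤ sSup ((fun x => |u x t|) '' K) := by
    refine Real.sSup_nonneg ?_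
    rintro _ ⟨x, _, rfl⟩
    exact abs_nonneg _
  rw [Real.dist_eq, sub_zero, abs_of_nonneg hnn]
  linarith
end
end

section
/- Consider the equation u_t = Δu + b(x,Du) − c(x,u) in ℝ₊^{n+1}, where |b(x,ξ)| ≤ φ(|ξ|) and c(x,ζ)·sign ζ ≥ ψ(|ζ|) for all x ∈ ℝⁿ, ζ ∈ ℝ∖{0}, ξ ∈ ℝⁿ, with φ : [0,∞) → [0,∞) and ψ : (0,∞) → (0,∞) non-decreasing continuous functions, φ a bijection of [0,∞) onto [0,∞), and liminf_{ζ→∞} φ^{−1}(ζ)/φ^{−1}(2ζ) > 0, where φ^{−1} is the inverse of φ. If ∫₁^∞ (ψ(ζ) ζ)^{−1/2} dζ < ∞ and ∫₁^∞ dζ / (φ^{−1}∘ψ)(ζ) < ∞, then every classical solution of the equation stabilizes to zero uniformly on every compact subset K of ℝⁿ as t → ∞, i.e. lim_{t→∞} sup_{x∈K} |u(x,t)| = 0. -/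
open Set Filter MeasureTheory Metric

noncomputable section

/-- Two-sided test: at a local maximum the second derivative is nonpositive. -/
theorem second_deriv_nonpos_of_isLocalMax {f f' : ℝ → ℝ} {f'' a : ℝ}
    (hf : ∀ᶠ s in nhds a, HasDerivAt f (f' s) s) (hf' : HasDerivAt f' f'' a)
    (hmax : IsLocalMax f a) : f'' ≤ 0 := by
  by_contra! hpos
  have hderiv : deriv f =ᶠ[nhds a] f' := hf.mono fun s hs => hs.deriv
  have hdd : deriv (deriv f) a = f'' := by rw [hderiv.deriv_eq, hf'.deriv]
  have hmin : IsLocalMin f a :=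
    isLocalMin_of_deriv_deriv_pos (by rwa [hdd]) hmax.deriv_eq_zero hf.self_of_nhds.continuousAt
  have hconst : f =ᶠ[nhds a] fun _ => f a := by
    filter_upwards [hmax, hmin] with s h1 h2 using le_antisymm h1 h2
  have h0 : deriv f =ᶠ[nhds a] fun _ => 0 := hconst.deriv.trans (by simp)
  have : deriv (deriv f) a = 0 := by rw [h0.deriv_eq]; simp
  linarith

/-- One-sided test: the derivative at a right-endpoint maximum is nonnegative. -/
theorem deriv_nonneg_of_forall_le_left {f : ℝ → ℝ} {d a b : ℝ} (hab : a < b)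
    (hf : HasDerivAt f d b) (hmax : ∀ s ∈ Icc a b, f s ≤ f b) : 0 ≤ d := by
  have h1 : Tendsto (slope f b) (nhdsWithin b (Iio b)) (nhds d) :=
    (hasDerivAt_iff_tendsto_slope.1 hf).mono_left (nhdsWithin_mono _ fun x hx => ne_of_lt hx)
  refine ge_of_tendsto h1 ?_
  filter_upwards [Ioo_mem_nhdsLT hab] with s hs
  rw [slope_def_field]
  exact div_nonneg_of_nonpos (by linarith [hmax s ⟨hs.1.le, hs.2.le⟩]) (by linarith [hs.2])

theorem ContinuousOn.integrableOn_Ioi_of_integrableOn_Ioi {f : ℝ → ℝ} {a b : ℝ}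
    (hf : ContinuousOn f (Icc b a)) (hint : IntegrableOn f (Ioi a)) : IntegrableOn f (Ioi b) :=
  (hf.integrableOn_Icc.union hint).mono_set fun x hx => by
    rcases le_or_gt x a with h | h
    · exact Or.inl ⟨(mem_Ioi.1 hx).le, h⟩
    · exact Or.inr h

/-- The mean value of `m` over `[0, w]`. -/
def meanUpTo (m : ℝ → ℝ) (w : ℝ) : ℝ := (∫ s in (0 : ℝ)..w, m s) / w

section meanUpTo

variable {m : ℝ → ℝ} {w : ℝ}

theorem hasDerivAt_meanUpTo (hm : Continuous m) (hw : 0 < w) :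
    HasDerivAt (meanUpTo m) ((m w - meanUpTo m w) / w) w := by
  have h := (intervalIntegral.integral_hasDerivAt_right (hm.intervalIntegrable 0 w)
    hm.aestronglyMeasurable.stronglyMeasurableAtFilter hm.continuousAt).div
    (hasDerivAt_id w) hw.ne'
  refine h.congr_deriv ?_
  simp only [meanUpTo, id]
  field_simp

theorem meanUpTo_pos (hm : Continuous m) (hpos : ∀ w, 0 < w → 0 < m w) (hw : 0 < w) :
    0 < meanUpTo m w :=
  div_pos (intervalIntegral.integral_pos hw hm.continuousOn (fun x hx => (hpos x hx.1).le)
    ⟨w, ⟨hw.le, le_rfl⟩, hpos w hw⟩) hw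

theorem meanUpTo_le (hm : Continuous m) (hmono : MonotoneOn m (Ici 0)) (hw : 0 < w) :
    meanUpTo m w ≤ m w := by
  rw [meanUpTo, div_le_iff₀ hw]
  have h := intervalIntegral.integral_mono_on hw.le (hm.intervalIntegrable (μ := volume) 0 w)
    (intervalIntegrable_const (c := m w)) (fun x hx => hmono hx.1 hw.le hx.2)
  rw [intervalIntegral.integral_const, smul_eq_mul] at h
  linarith

theorem half_le_meanUpTo (hm : Continuous m) (hmono : MonotoneOn m (Ici 0))
    (hpos : ∀ w, 0 < w → 0 < m w) (hw : 0 < w) : m (w / 2) / 2 ≤ meanUpTo m w := by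
  rw [meanUpTo, le_div_iff₀ hw, ← intervalIntegral.integral_add_adjacent_intervals
    (hm.intervalIntegrable 0 (w / 2)) (hm.intervalIntegrable (w / 2) w)]
  have h1 : 0 < ∫ s in (0 : ℝ)..w / 2, m s :=
    intervalIntegral.integral_pos (half_pos hw) hm.continuousOn (fun x hx => (hpos x hx.1).le)
      ⟨w / 2, ⟨by linarith, le_rfl⟩, hpos _ (half_pos hw)⟩
  have h2 := intervalIntegral.integral_mono_on (by linarith : w / 2 ≤ w)
    (intervalIntegrable_const (c := m (w / 2))) (hm.intervalIntegrable (μ := volume) (w / 2) w)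
    (fun x hx => hmono (by simp; linarith) (by simp; linarith [hx.1]) hx.1)
  rw [intervalIntegral.integral_const, smul_eq_mul] at h2
  linarith

theorem integrableOn_inv_meanUpTo (hm : Continuous m) (hmono : MonotoneOn m (Ici 0))
    (hpos : ∀ w, 0 < w → 0 < m w) {a : ℝ} (hint : IntegrableOn (fun w => (m w)⁻¹) (Ioi a)) :
    IntegrableOn (fun w => (meanUpTo m w)⁻¹) (Ioi 1) := by
  have h1 : IntegrableOn (fun w => (m w)⁻¹) (Ioi (1 / 2)) :=
    ContinuousOn.integrableOn_Ioi_of_integrableOn_Ioi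
      (hm.continuousOn.inv₀ fun x hx => (hpos x (by linarith [hx.1])).ne') hint
  have h2 : IntegrableOn (fun w => 2 * (m (1 / 2 * w))⁻¹) (Ioi 1) :=
    ((integrableOn_Ioi_comp_mul_left_iff (fun w => (m w)⁻¹) 1 (by norm_num : (0 : ℝ) < 1 / 2)).2
      (by simpa using h1)).const_mul 2
  refine Integrable.mono' h2 ?_ ?_
  · refine ContinuousOn.aestronglyMeasurable (fun x hx => ?_) measurableSet_Ioi
    have hx0 : 0 < x := zero_lt_one.trans hx
    exact ((hasDerivAt_meanUpTo hm hx0).continuousAt.inv₀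
      (meanUpTo_pos hm hpos hx0).ne').continuousWithinAt
  · refine (ae_restrict_iff' measurableSet_Ioi).2 (Eventually.of_forall fun x hx => ?_)
    have hx0 : 0 < x := zero_lt_one.trans hx
    rw [Real.norm_of_nonneg (inv_nonneg.2 (meanUpTo_pos hm hpos hx0).le)]
    have h3 := half_le_meanUpTo hm hmono hpos hx0
    have h4 := hpos (x / 2) (half_pos hx0)
    calc (meanUpTo m x)⁻¹ ≤ (m (x / 2) / 2)⁻¹ := inv_anti₀ (by positivity) h3
      _ = 2 * (m (1 / 2 * x))⁻¹ := by
        rw [inv_div, div_eq_mul_inv, show 1 / 2 * x = x / 2 by ring]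

end meanUpTo

/-- The equation `W' = g(W)` has a positive solution on `(-∞, 0)` which blows up at `0` and decays
at `-∞`, provided that `1 / g` is integrable at infinity and `g` is at most linear at zero. -/
theorem exists_solution_blowup {g : ℝ → ℝ} (hg : ContinuousOn g (Ioi 0))
    (hpos : ∀ w, 0 < w → 0 < g w) {C : ℝ} (hC : ∀ w, 0 < w → w ≤ 1 → g w ≤ C * w)
    (hint : IntegrableOn (fun w => (g w)⁻¹) (Ioi 1)) :
    ∃ W : ℝ → ℝ, (∀ x < 0, 0 < W x ∧ HasDerivAt W (g (W x)) x) ∧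
      (∀ M, ∃ x < 0, ∀ y, x ≤ y → y < 0 → M ≤ W y) ∧
      (∀ δ > 0, ∃ x < 0, ∀ y ≤ x, W y ≤ δ) := by
  set k : ℝ → ℝ := fun w => (g w)⁻¹ with hk
  have hkc : ContinuousOn k (Ioi 0) := hg.inv₀ fun x hx => (hpos x hx).ne'
  have hkpos : ∀ w, 0 < w → 0 < k w := fun w hw => inv_pos.2 (hpos w hw)
  have hki : ∀ a b, 0 < a → 0 < b → IntervalIntegrable k volume a b := fun a b ha hb =>
    (hkc.mono fun x hx => (lt_min ha hb).trans_le hx.1).intervalIntegrable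
  set Φ : ℝ → ℝ := fun w => ∫ s in (1 : ℝ)..w, k s with hΦ
  have hΦd : ∀ w, 0 < w → HasDerivAt Φ (k w) w := fun w hw =>
    intervalIntegral.integral_hasDerivAt_right (hki 1 w one_pos hw)
      (hkc.stronglyMeasurableAtFilter isOpen_Ioi w hw) (hkc.continuousAt (Ioi_mem_nhds hw))
  have hΦc : ContinuousOn Φ (Ioi 0) := fun w hw => (hΦd w hw).continuousAt.continuousWithinAt
  have hΦm : StrictMonoOn Φ (Ioi 0) := strictMonoOn_of_deriv_pos (convex_Ioi 0) hΦc fun w hw => by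
    rw [interior_Ioi] at hw
    rw [(hΦd w hw).deriv]; exact hkpos w hw
  set L := ∫ s in Ioi (1 : ℝ), k s with hL
  have hlim : Tendsto Φ atTop (nhds L) := intervalIntegral_tendsto_integral_Ioi 1 hint tendsto_id
  have hlt : ∀ w, 0 < w → Φ w < L := fun w hw => by
    refine (hΦm hw (by simp; linarith) (lt_add_one w)).trans_le (ge_of_tendsto hlim ?_)
    filter_upwards [eventually_ge_atTop (w + 1)] with s hs
    exact hΦm.monotoneOn (by simp; linarith) (by simp; linarith) hs
  have hC0 : 0 < C := by have := hpos 1 one_pos; have := hC 1 one_pos le_rfl; linarith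
  have hlog : ∀ w, 0 < w → w ≤ 1 → Φ w ≤ C⁻¹ * Real.log w := fun w hw hw1 => by
    have h1 : ∫ s in w..1, C⁻¹ * s⁻¹ ≤ ∫ s in w..1, k s := by
      refine intervalIntegral.integral_mono_on hw1 ?_ (hki w 1 hw one_pos) fun x hx => ?_
      · refine ContinuousOn.intervalIntegrable ?_
        rw [uIcc_of_le hw1]
        exact continuousOn_const.mul (continuousOn_inv₀.mono fun x hx => by
          simp; linarith [hx.1])
      · have hx0 : 0 < x := hw.trans_le hx.1
        rw [← mul_inv]
        exact inv_anti₀ (hpos x hx0) (hC x hx0 hx.2)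
    rw [intervalIntegral.integral_const_mul, integral_inv_of_pos hw one_pos, one_div,
      Real.log_inv, intervalIntegral.integral_symm] at h1
    simp only [hΦ]; linarith
  have hsurj : ∀ y, y < L → ∃ w, 0 < w ∧ Φ w = y := fun y hy => by
    obtain ⟨b, hb, hb1⟩ := ((hlim.eventually (lt_mem_nhds hy)).and (eventually_ge_atTop 1)).exists
    set a := Real.exp (min (C * y) 0) with ha
    have ha1 : a ≤ 1 := Real.exp_le_one_iff.2 (min_le_right _ _)
    have ha0 : 0 < a := Real.exp_pos _
    have hay : Φ a ≤ y := by
      refine (hlog a ha0 ha1).trans ?_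
      rw [ha, Real.log_exp, inv_mul_le_iff₀ hC0]
      exact min_le_left _ _
    obtain ⟨w, hw, hwy⟩ := intermediate_value_Icc (ha1.trans hb1)
      (hΦc.mono fun x hx => ha0.trans_le hx.1) ⟨hay, hb.le⟩
    exact ⟨w, ha0.trans_le hw.1, hwy⟩
  have hex : ∀ x, ∃ w, x < 0 → 0 < w ∧ Φ w = x + L := fun x => by
    by_cases hx : x < 0
    · obtain ⟨w, hw⟩ := hsurj (x + L) (by linarith)
      exact ⟨w, fun _ => hw⟩
    · exact ⟨0, fun h => absurd h hx⟩
  choose W hW using hex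
  have hWm : StrictMonoOn W (Iio 0) := fun x hx y hy hxy =>
    (hΦm.lt_iff_lt (hW x hx).1 (hW y hy).1).1 (by rw [(hW x hx).2, (hW y hy).2]; linarith)
  have hWinv : ∀ w, 0 < w → Φ w - L < 0 ∧ W (Φ w - L) = w := fun w hw => by
    have h0 : Φ w - L < 0 := by linarith [hlt w hw]
    refine ⟨h0, hΦm.injOn (hW _ h0).1 hw ?_⟩
    rw [(hW _ h0).2]; ring
  refine ⟨W, fun x hx => ⟨(hW x hx).1, ?_⟩, fun M => ?_, fun δ hδ => ?_⟩
  · have himg : Ioi 0 ⊆ W '' Iio 0 := fun w hw => ⟨Φ w - L, hWinv w hw⟩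
    have hc : ContinuousAt W x := hWm.continuousAt_of_image_mem_nhds (Iio_mem_nhds hx)
      (mem_of_superset (Ioi_mem_nhds (hW x hx).1) himg)
    have := HasDerivAt.of_local_left_inverse (f := fun w => Φ w - L) hc
      ((hΦd _ (hW x hx).1).sub_const L) (hkpos _ (hW x hx).1).ne' (by
        filter_upwards [Iio_mem_nhds hx] with y hy
        rw [(hW y hy).2]; ring)
    simpa [hk] using this
  · have hM := hWinv (max M 1) (by simp)
    refine ⟨_, hM.1, fun y hy hy0 => (le_max_left M 1).trans ?_⟩
    calc max M 1 = W _ := hM.2.symm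
      _ ≤ W y := hWm.monotoneOn hM.1 hy0 hy
  · have hD := hWinv δ hδ
    exact ⟨_, hD.1, fun y hy => (hWm.monotoneOn (hy.trans_lt hD.1) hD.1 hy).trans hD.2.le⟩

/-- A boundary blow-up profile whose first and second derivatives are controlled by `m`. -/
theorem exists_blowup_profile {m : ℝ → ℝ} (hm : Continuous m) (hmono : MonotoneOn m (Ici 0))
    (hpos : ∀ w, 0 < w → 0 < m w) {C : ℝ} (hC : ∀ w, 0 < w → w ≤ 1 → m w ≤ C * w) {a : ℝ}
    (hint : IntegrableOn (fun w => (m w)⁻¹) (Ioi a)) :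
    ∃ W W' W'' : ℝ → ℝ, (∀ x < 0, 0 < W x ∧ HasDerivAt W (W' x) x ∧ HasDerivAt W' (W'' x) x ∧
        0 ≤ W' x ∧ W' x ≤ m (W x) ∧ W'' x ≤ m (W x) ^ 2 / W x) ∧
      (∀ M, ∃ x < 0, ∀ y, x ≤ y → y < 0 → M ≤ W y) ∧
      (∀ δ > 0, ∃ x < 0, ∀ y ≤ x, W y ≤ δ) := by
  obtain ⟨W, hW, hM, hδ⟩ := exists_solution_blowup (g := meanUpTo m) (C := C)
    (fun w hw => (hasDerivAt_meanUpTo hm hw).continuousAt.continuousWithinAt)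
    (fun w hw => meanUpTo_pos hm hpos hw)
    (fun w hw hw1 => (meanUpTo_le hm hmono hw).trans (hC w hw hw1))
    (integrableOn_inv_meanUpTo hm hmono hpos hint)
  refine ⟨W, fun x => meanUpTo m (W x),
    fun x => (m (W x) - meanUpTo m (W x)) / W x * meanUpTo m (W x), fun x hx => ?_, hM, hδ⟩
  obtain ⟨h0, hd⟩ := hW x hx
  have hp := meanUpTo_pos hm hpos h0
  have hl := meanUpTo_le hm hmono h0
  refine ⟨h0, hd, (hasDerivAt_meanUpTo hm h0).comp x hd, hp.le, hl, ?_⟩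
  beta_reduce
  rw [div_mul_eq_mul_div]
  gcongr
  nlinarith

section inverse

variable {φ φinv : ℝ → ℝ}

theorem monotoneOn_of_invOn (hφ : ∀ s t : ℝ, 0 ≤ s → s ≤ t → φ s ≤ φ t)
    (hbij : BijOn φ (Ici 0) (Ici 0)) (hinv : InvOn φinv φ (Ici 0) (Ici 0)) :
    MonotoneOn φinv (Ici 0) := fun x hx y hy hxy => by
  by_contra! hlt
  have hmem : ∀ z ∈ Ici (0 : ℝ), φinv z ∈ Ici (0 : ℝ) :=
    hinv.1.mapsTo hbij.surjOn
  have h := hφ _ _ (hmem y hy) hlt.le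
  rw [hinv.2 hx, hinv.2 hy] at h
  exact hlt.ne' (by rw [le_antisymm hxy h])

theorem map_zero_of_bijOn (hφ : ∀ s t : ℝ, 0 ≤ s → s ≤ t → φ s ≤ φ t)
    (hbij : BijOn φ (Ici 0) (Ici 0)) : φ 0 = 0 := by
  obtain ⟨s, hs, hs0⟩ := hbij.surjOn (self_mem_Ici : (0 : ℝ) ∈ Ici 0)
  exact le_antisymm ((hφ 0 s le_rfl hs).trans hs0.le) (hbij.mapsTo self_mem_Ici)

theorem continuous_inv_max_zero (hφ : ∀ s t : ℝ, 0 ≤ s → s ≤ t → φ s ≤ φ t)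
    (hbij : BijOn φ (Ici 0) (Ici 0)) (hinv : InvOn φinv φ (Ici 0) (Ici 0)) :
    Continuous fun y => φinv (max y 0) := by
  have hmono := monotoneOn_of_invOn hφ hbij hinv
  have h0 : φinv 0 = 0 := by
    conv_lhs => rw [← map_zero_of_bijOn hφ hbij]
    exact hinv.1 self_mem_Ici
  have hF : Continuous fun y => φinv (max y 0) + min y 0 := by
    refine Monotone.continuous_of_surjective (fun x y hxy => ?_) fun y => ?_
    · exact add_le_add (hmono (by simp) (by simp) (max_le_max hxy le_rfl)) (min_le_min hxy le_rfl)
    · rcases le_total 0 y with hy | hy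
      · have hφy : 0 ≤ φ y := hbij.mapsTo hy
        exact ⟨φ y, by simp [hφy, hinv.1 (mem_Ici.2 hy)]⟩
      · exact ⟨y, by simp [hy, h0]⟩
  exact (hF.sub (continuous_id.min (continuous_const (y := (0 : ℝ))))).congr fun y => by simp

end inverse

theorem inv_min_le_add {p q : ℝ} (hp : 0 < p) (hq : 0 < q) : (min p q)⁻¹ ≤ p⁻¹ + q⁻¹ := by
  rcases min_choice p q with h | h <;> rw [h] <;>
    linarith [inv_pos.2 hp, inv_pos.2 hq]

/-- Under the doubling condition, `φ⁻¹` of a quarter controls `φ⁻¹`. -/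
theorem exists_inv_quarter_bound {φinv : ℝ → ℝ} (hpos : ∀ y, 0 < y → 0 < φinv y)
    (hliminf : 0 < liminf (fun ζ : ℝ => φinv ζ / φinv (2 * ζ)) atTop) :
    ∃ K N : ℝ, 0 < K ∧ 0 < N ∧ ∀ y, N ≤ y → (φinv (y / 4))⁻¹ ≤ K * (φinv y)⁻¹ := by
  obtain ⟨c, hc0, hc⟩ := exists_between hliminf
  have hbdd : IsBoundedUnder (· ≥ ·) atTop fun ζ : ℝ => φinv ζ / φinv (2 * ζ) := by
    refine ⟨0, eventually_map.2 ?_⟩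
    filter_upwards [eventually_gt_atTop 0] with y hy
    exact (div_pos (hpos y hy) (hpos _ (by linarith))).le
  obtain ⟨N, hN⟩ := eventually_atTop.1 (eventually_lt_of_lt_liminf hc hbdd)
  have hstep : ∀ y, max N 1 ≤ y → c * φinv (2 * y) ≤ φinv y := fun y hy => by
    have h1 : 0 < y := by linarith [le_max_right N 1]
    have h2 := hN y ((le_max_left _ _).trans hy)
    rw [lt_div_iff₀ (hpos _ (by linarith))] at h2
    exact h2.le
  refine ⟨(c * c)⁻¹, 4 * max N 1, by positivity, by positivity, fun y hy => ?_⟩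
  have h1 : 0 < y := by linarith [le_max_right N 1]
  have h2 := hstep (y / 4) (by linarith)
  have h3 := hstep (y / 2) (by linarith [le_max_right N 1])
  rw [show 2 * (y / 4) = y / 2 by ring] at h2
  rw [show 2 * (y / 2) = y by ring] at h3
  rw [← mul_inv]
  refine inv_anti₀ (mul_pos (mul_pos hc0 hc0) (hpos y h1)) ?_
  nlinarith

/-- Existence of the one-dimensional boundary blow-up profile adapted to `φ` and `ψ`. -/
theorem exists_barrier_s6 {n : ℕ} (hn : 1 ≤ n) {φ ψ φinv : ℝ → ℝ}
    (hφ_mono : ∀ s t : ℝ, 0 ≤ s → s ≤ t → φ s ≤ φ t)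
    (hφ_bij : BijOn φ (Ici 0) (Ici 0)) (hφinv : InvOn φinv φ (Ici 0) (Ici 0))
    (hψ_mono : ∀ s t : ℝ, 0 < s → s ≤ t → ψ s ≤ ψ t)
    (hψ_cont : ContinuousOn ψ (Ioi 0)) (hψ_pos : ∀ s : ℝ, 0 < s → 0 < ψ s)
    (hliminf : 0 < liminf (fun ζ : ℝ => φinv ζ / φinv (2 * ζ)) atTop)
    (hint₁ : IntegrableOn (fun ζ : ℝ => (Real.sqrt (ψ ζ * ζ))⁻¹) (Ioi 1))
    (hint₂ : IntegrableOn (fun ζ : ℝ => (φinv (ψ ζ))⁻¹) (Ioi 1)) {ε : ℝ} (hε : 0 < ε) :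
    ∃ W W' W'' : ℝ → ℝ, (∀ x < 0, 0 < W x ∧ HasDerivAt W (W' x) x ∧ HasDerivAt W' (W'' x) x ∧
        0 ≤ W' x ∧ W' x ≤ φinv (ψ (W x + ε) / 4) / n ∧ W'' x ≤ ψ (W x + ε) / (8 * n)) ∧
      (∀ M, ∃ x < 0, ∀ y, x ≤ y → y < 0 → M ≤ W y) ∧
      (∀ δ > 0, ∃ x < 0, ∀ y ≤ x, W y ≤ δ) := by
  have hn0 : (0 : ℝ) < n := by exact_mod_cast hn
  have hinv_mono := monotoneOn_of_invOn hφ_mono hφ_bij hφinv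
  have hinv_mem : MapsTo φinv (Ici 0) (Ici 0) := hφinv.1.mapsTo hφ_bij.surjOn
  have hinv_pos : ∀ y, 0 < y → 0 < φinv y := fun y hy => by
    refine lt_of_le_of_ne (hinv_mem hy.le) fun h => hy.ne ?_
    rw [← hφinv.2 (mem_Ici.2 hy.le), ← h, map_zero_of_bijOn hφ_mono hφ_bij]
  have habs : ∀ w : ℝ, 0 < |w| + ε := fun w => by positivity
  have hψc : Continuous fun w : ℝ => ψ (|w| + ε) :=
    hψ_cont.comp_continuous (by fun_prop) fun w => habs w
  have hψp : ∀ w : ℝ, 0 < ψ (|w| + ε) := fun w => hψ_pos _ (habs w)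
  set h : ℝ → ℝ := fun w => φinv (ψ (|w| + ε) / 4) / n with hh
  set A : ℝ → ℝ := fun w => ψ (|w| + ε) / (8 * n) with hA
  have hhpos : ∀ w, 0 < h w := fun w => div_pos (hinv_pos _ (by linarith [hψp w])) hn0
  have hApos : ∀ w, 0 < A w := fun w => div_pos (hψp w) (by linarith)
  have hhc : Continuous h := by
    have h1 := (continuous_inv_max_zero hφ_mono hφ_bij hφinv).comp (hψc.div_const 4)
    refine (h1.div_const (n : ℝ)).congr fun w => ?_
    simp only [hh, Function.comp]
    rw [max_eq_left (by linarith [hψp w])]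
  have hAc : Continuous A := hψc.div_const _
  have hψabs : ∀ x y : ℝ, 0 ≤ x → x ≤ y → ψ (|x| + ε) ≤ ψ (|y| + ε) := fun x y hx hxy =>
    hψ_mono _ _ (habs x) (by rw [abs_of_nonneg hx, abs_of_nonneg (hx.trans hxy)]; linarith)
  have hhm : ∀ x y : ℝ, 0 ≤ x → x ≤ y → h x ≤ h y := fun x y hx hxy => by
    refine div_le_div_of_nonneg_right (hinv_mono ?_ ?_ ?_) hn0.le
    · simp only [mem_Ici]; linarith [hψp x]
    · simp only [mem_Ici]; linarith [hψp y]
    · linarith [hψabs x y hx hxy]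
  have hAm : ∀ x y : ℝ, 0 ≤ x → x ≤ y → A x ≤ A y := fun x y hx hxy =>
    div_le_div_of_nonneg_right (hψabs x y hx hxy) (by linarith)
  set m : ℝ → ℝ := fun w => min (h w) √(A w * |w|) * min 1 √|w| with hm
  have hmc : Continuous m := by fun_prop
  have hmm : MonotoneOn m (Ici 0) := fun x hx y hy hxy => by
    have hx' : 0 ≤ x := hx
    have hy' : 0 ≤ y := hy
    have h1 : |x| ≤ |y| := by rwa [abs_of_nonneg hx', abs_of_nonneg hy']
    refine mul_le_mul (min_le_min (hhm x y hx hxy) (Real.sqrt_le_sqrt ?_))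
      (min_le_min le_rfl (Real.sqrt_le_sqrt h1)) (by positivity)
      (le_min (hhpos y).le (Real.sqrt_nonneg _))
    exact mul_le_mul (hAm x y hx hxy) h1 (abs_nonneg _) (hApos y).le
  have hmp : ∀ w, 0 < w → 0 < m w := fun w hw => by
    have h1 : 0 < |w| := abs_pos.2 hw.ne'
    exact mul_pos (lt_min (hhpos w) (Real.sqrt_pos.2 (mul_pos (hApos w) h1)))
      (lt_min one_pos (Real.sqrt_pos.2 h1))
  have hmC : ∀ w, 0 < w → w ≤ 1 → m w ≤ √(A 1) * w := fun w hw hw1 => by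
    calc m w ≤ √(A w * |w|) * √|w| := mul_le_mul (min_le_right _ _) (min_le_right _ _)
          (by positivity) (Real.sqrt_nonneg _)
      _ = √(A w) * w := by
        rw [Real.sqrt_mul (hApos w).le, mul_assoc, Real.mul_self_sqrt (abs_nonneg w),
          abs_of_pos hw]
      _ ≤ √(A 1) * w := by gcongr; exact hAm w 1 hw.le hw1
  obtain ⟨K, N, hK, hN, hquarter⟩ := exists_inv_quarter_bound hinv_pos hliminf
  obtain ⟨a, ha1, haN⟩ : ∃ a : ℝ, 1 ≤ a ∧ N ≤ ψ a := by
    by_contra! hcon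
    have hconst : IntegrableOn (fun _ : ℝ => (φinv N)⁻¹) (Ioi 1) := by
      refine Integrable.mono' hint₂ aestronglyMeasurable_const
        ((ae_restrict_iff' measurableSet_Ioi).2 (Eventually.of_forall fun x hx => ?_))
      have hx1 : 1 < x := hx
      have hψx := hψ_pos x (by linarith)
      rw [Real.norm_of_nonneg (inv_nonneg.2 (hinv_pos N hN).le)]
      exact inv_anti₀ (hinv_pos _ hψx) (hinv_mono hψx.le hN.le (hcon x hx1.le).le)
    rw [integrableOn_const_iff] at hconst
    rcases hconst with h0 | h0
    · exact (inv_pos.2 (hinv_pos N hN)).ne' (by simpa using h0)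
    · simp at h0
  have hmint : IntegrableOn (fun w => (m w)⁻¹) (Ioi a) := by
    have hdom := ((hint₂.const_mul (n * K)).add (hint₁.const_mul √(8 * n))).mono_measure
      (Measure.restrict_mono_set volume (Ioi_subset_Ioi ha1))
    refine Integrable.mono' hdom ?_
      ((ae_restrict_iff' measurableSet_Ioi).2 (Eventually.of_forall fun x hx => ?_))
    · refine ContinuousOn.aestronglyMeasurable (hmc.continuousOn.inv₀ fun x hx => ?_)
        measurableSet_Ioi
      exact (hmp x (by linarith [mem_Ioi.1 hx])).ne'
    · have hxa : a < x := hx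
      have hx0 : 0 < x := by linarith
      have hax : |x| = x := abs_of_pos hx0
      have hψx := hψ_pos x hx0
      have hψε : ψ x ≤ ψ (|x| + ε) := hψ_mono _ _ hx0 (by rw [hax]; linarith)
      have hmx : m x = min (h x) √(A x * |x|) := by
        simp only [hm]
        rw [min_eq_left (b := √|x|), mul_one]
        rw [hax]; exact Real.one_le_sqrt.2 (by linarith)
      have hq : 0 < √(A x * |x|) := Real.sqrt_pos.2 (mul_pos (hApos x) (by rwa [hax]))
      rw [Real.norm_of_nonneg (inv_nonneg.2 (hmp x hx0).le), hmx]
      refine (inv_min_le_add (hhpos x) hq).trans (add_le_add ?_ ?_)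
      · have h1 : (h x)⁻¹ = n * (φinv (ψ (|x| + ε) / 4))⁻¹ := by
          simp only [hh]; rw [inv_div, div_eq_mul_inv]
        beta_reduce
        rw [h1, mul_assoc]
        refine mul_le_mul_of_nonneg_left ?_ hn0.le
        refine le_trans (inv_anti₀ (hinv_pos _ (by linarith)) (hinv_mono ?_ ?_ ?_))
          (hquarter (ψ x) (haN.trans (hψ_mono _ _ (by linarith) hxa.le)))
        · simp only [mem_Ici]; linarith
        · simp only [mem_Ici]; linarith
        · linarith
      · have h1 : √(ψ x * x) / √(8 * n) ≤ √(A x * |x|) := by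
          rw [← Real.sqrt_div' _ (by positivity), hax]
          refine Real.sqrt_le_sqrt ?_
          simp only [hA]
          rw [div_mul_eq_mul_div]
          gcongr
        refine (inv_anti₀ (by positivity) h1).trans_eq ?_
        rw [inv_div, div_eq_mul_inv]
  obtain ⟨W, W', W'', hW, hM, hδ⟩ := exists_blowup_profile hmc hmm hmp hmC hmint
  refine ⟨W, W', W'', fun x hx => ?_, hM, hδ⟩
  obtain ⟨h0, hd, hdd, hnn, hle, hle2⟩ := hW x hx
  have hab : |W x| = W x := abs_of_pos h0
  have hmmin : m (W x) ≤ min (h (W x)) √(A (W x) * |W x|) :=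
    mul_le_of_le_one_right (le_min (hhpos _).le (Real.sqrt_nonneg _)) (min_le_left _ _)
  refine ⟨h0, hd, hdd, hnn, (hle.trans (hmmin.trans (min_le_left _ _))).trans_eq ?_,
    hle2.trans ?_⟩
  · simp only [hh, hab]
  · have h1 : m (W x) ^ 2 ≤ A (W x) * W x := by
      calc m (W x) ^ 2 ≤ √(A (W x) * |W x|) ^ 2 :=
            pow_le_pow_left₀ (hmp _ h0).le (hmmin.trans (min_le_right _ _)) 2
        _ = A (W x) * W x := by rw [Real.sq_sqrt (by positivity [hApos (W x)]), hab]
    rw [div_le_iff₀ h0]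
    simpa only [hA, hab] using h1

/-- The closed cube of half-side `r` centred at the origin. -/
def closedCube (n : ℕ) (r : ℝ) : Set (Eucl n) := {x | ∀ i, |x i| ≤ r}

theorem isCompact_closedCube (n : ℕ) (r : ℝ) : IsCompact (closedCube n r) := by
  have h : closedCube n r = WithLp.toLp 2 '' Set.pi univ fun _ : Fin n => Icc (-r) r := by
    ext x
    exact ⟨fun hx => ⟨WithLp.ofLp x, fun i _ => abs_le.1 (hx i), rfl⟩, by
      rintro ⟨y, hy, rfl⟩ i; exact abs_le.2 (hy i (mem_univ i))⟩
  rw [h]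
  exact (isCompact_univ_pi fun _ => isCompact_Icc).image (PiLp.continuous_toLp _ _)

theorem eucl_norm_le_sum {n : ℕ} (v : Eucl n) : ‖v‖ ≤ ∑ i, |v i| := by
  rw [EuclideanSpace.norm_eq]
  refine Real.sqrt_le_iff.2 ⟨Finset.sum_nonneg fun i _ => abs_nonneg _, ?_⟩
  exact Finset.sum_sq_le_sq_sum_of_nonneg fun i _ => abs_nonneg _

/-- Shifting a partial derivative along the `i`-th coordinate line. -/
theorem hasDerivAt_line_s6 {n : ℕ} {v v' : Eucl n → ℝ} {i : Fin n}
    (hv : ∀ x, HasDerivAt (fun s : ℝ => v (x + s • EuclideanSpace.single i (1 : ℝ))) (v' x) 0)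
    (x : Eucl n) (s : ℝ) :
    HasDerivAt (fun s : ℝ => v (x + s • EuclideanSpace.single i (1 : ℝ)))
      (v' (x + s • EuclideanSpace.single i (1 : ℝ))) s := by
  have h := hv (x + s • EuclideanSpace.single i (1 : ℝ))
  rw [← sub_self s] at h
  refine (HasDerivAt.comp_sub_const s s h).congr_of_eventuallyEq (Eventually.of_forall fun r => ?_)
  simp only [add_assoc, ← add_smul, add_sub_cancel]

theorem add_smul_single_apply {n : ℕ} (x : Eucl n) (s : ℝ) (i j : Fin n) :
    (x + s • EuclideanSpace.single i (1 : ℝ)) j = if j = i then x i + s else x j := by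
  by_cases h : j = i
  · subst h; simp
  · simp [h]

theorem sum_add_smul_single {n : ℕ} (B : ℝ → ℝ) (x : Eucl n) (s : ℝ) (i : Fin n) :
    ∑ j, B ((x + s • EuclideanSpace.single i (1 : ℝ)) j) =
      ∑ j, B (x j) + (B (x i + s) - B (x i)) := by
  rw [← Finset.add_sum_erase (M := ℝ) _ _ (Finset.mem_univ i),
    ← Finset.add_sum_erase (f := fun j => B (x j)) _ (Finset.mem_univ i)]
  have h : ∑ j ∈ Finset.univ.erase i, B ((x + s • EuclideanSpace.single i (1 : ℝ)) j) =
      ∑ j ∈ Finset.univ.erase i, B (x j) := Finset.sum_congr rfl fun j hj => by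
    rw [add_smul_single_apply, if_neg (Finset.ne_of_mem_erase hj)]
  rw [h, add_smul_single_apply, if_pos rfl]
  ring

/-- Necessary conditions at an interior maximum of `v - ∑ i, B (x i)`. -/
theorem gradient_hessian_at_max {n : ℕ} {v : Eucl n → ℝ} {dv : Eucl n → Eucl n}
    {d2v : Eucl n → Fin n → Fin n → ℝ}
    (hdv : ∀ x i, HasDerivAt (fun s : ℝ => v (x + s • EuclideanSpace.single i (1 : ℝ))) (dv x i) 0)
    (hd2v : ∀ x i j,
      HasDerivAt (fun s : ℝ => dv (x + s • EuclideanSpace.single j (1 : ℝ)) i) (d2v x i j) 0)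
    {B B' B'' : ℝ → ℝ} {r : ℝ} (hB : ∀ y, |y| < r → HasDerivAt B (B' y) y)
    (hB' : ∀ y, |y| < r → HasDerivAt B' (B'' y) y) {x : Eucl n} (hx : ∀ i, |x i| < r)
    (hmax : ∀ y ∈ closedCube n r, v y - ∑ i, B (y i) ≤ v x - ∑ i, B (x i)) (i : Fin n) :
    dv x i = B' (x i) ∧ d2v x i i ≤ B'' (x i) := by
  have hnear : ∀ᶠ s : ℝ in nhds 0, |x i + s| < r :=
    (show Continuous fun s : ℝ => |x i + s| by fun_prop).continuousAt.eventually_lt_const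
      (by simpa using hx i)
  have hloc : IsLocalMax
      (fun s : ℝ => v (x + s • EuclideanSpace.single i (1 : ℝ)) - B (x i + s)) 0 := by
    filter_upwards [hnear] with s hs
    have h := hmax (x + s • EuclideanSpace.single i (1 : ℝ)) fun j => by
      rw [add_smul_single_apply]
      split_ifs
      · exact hs.le
      · exact (hx j).le
    rw [sum_add_smul_single] at h
    simp only [zero_smul, add_zero]
    linarith
  have hd : ∀ᶠ s : ℝ in nhds 0, HasDerivAt
      (fun s : ℝ => v (x + s • EuclideanSpace.single i (1 : ℝ)) - B (x i + s))
      (dv (x + s • EuclideanSpace.single i (1 : ℝ)) i - B' (x i + s)) s := by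
    filter_upwards [hnear] with s hs
    exact (hasDerivAt_line_s6 (v' := fun y => dv y i) (fun y => hdv y i) x s).sub
      ((hB _ hs).comp_const_add (x i) s)
  have hdd : HasDerivAt
      (fun s : ℝ => dv (x + s • EuclideanSpace.single i (1 : ℝ)) i - B' (x i + s))
      (d2v x i i - B'' (x i)) 0 :=
    (hd2v x i i).sub (HasDerivAt.comp_const_add (x i) 0 (by simpa using hB' _ (hx i)))
  refine ⟨?_, by linarith [second_deriv_nonpos_of_isLocalMax hd hdd hloc]⟩
  have := hloc.hasDerivAt_eq_zero hd.self_of_nhds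
  simp only [zero_smul, add_zero] at this
  linarith

/-- Comparison of a subsolution with the explicit supersolution
`∑ i, (W (x i - ρ) + W (-x i - ρ)) + ε + M₀ exp (-κ (t - 1))`. -/
theorem le_barrier {n : ℕ} (hn : 1 ≤ n) {φ ψ φinv : ℝ → ℝ}
    (hφ_mono : ∀ s t : ℝ, 0 ≤ s → s ≤ t → φ s ≤ φ t)
    (hφ_bij : BijOn φ (Ici 0) (Ici 0)) (hφinv : InvOn φinv φ (Ici 0) (Ici 0))
    (hψ_mono : ∀ s t : ℝ, 0 < s → s ≤ t → ψ s ≤ ψ t) (hψ_pos : ∀ s : ℝ, 0 < s → 0 < ψ s)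
    {u : Eucl n → ℝ → ℝ} {du : Eucl n → ℝ → Eucl n} {d2u : Eucl n → ℝ → Fin n → Fin n → ℝ}
    {ut : Eucl n → ℝ → ℝ}
    (hdu : ∀ (x : Eucl n) (t : ℝ), 0 < t → ∀ i,
      HasDerivAt (fun s : ℝ => u (x + s • EuclideanSpace.single i (1 : ℝ)) t) (du x t i) 0)
    (hd2u : ∀ (x : Eucl n) (t : ℝ), 0 < t → ∀ i j,
      HasDerivAt (fun s : ℝ => du (x + s • EuclideanSpace.single j (1 : ℝ)) t i) (d2u x t i j) 0)
    (hut : ∀ (x : Eucl n) (t : ℝ), 0 < t → HasDerivAt (fun τ : ℝ => u x τ) (ut x t) t)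
    (hu_cont : ContinuousOn (fun q : Eucl n × ℝ => u q.1 q.2) (univ ×ˢ Ioi 0))
    (hsub : ∀ (x : Eucl n) (t : ℝ), 0 < t → 0 < u x t →
      ut x t ≤ (∑ i, d2u x t i i) + φ ‖du x t‖ - ψ (u x t))
    {W W' W'' : ℝ → ℝ} {ε : ℝ} (hε : 0 < ε)
    (hW : ∀ x < 0, 0 < W x ∧ HasDerivAt W (W' x) x ∧ HasDerivAt W' (W'' x) x ∧
      0 ≤ W' x ∧ W' x ≤ φinv (ψ (W x + ε) / 4) / n ∧ W'' x ≤ ψ (W x + ε) / (8 * n))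
    (hWtop : ∀ M, ∃ x < 0, ∀ y, x ≤ y → y < 0 → M ≤ W y)
    {ρ M₀ κ : ℝ} (hρ : 0 < ρ) (hM₀ : 0 ≤ M₀) (hκ : 0 ≤ κ) (hκM₀ : κ * M₀ ≤ ψ ε / 4)
    (hinit : ∀ x ∈ closedCube n ρ, u x 1 ≤ M₀)
    {t : ℝ} (ht : 1 ≤ t) {x : Eucl n} (hx : ∀ i, |x i| < ρ) :
    u x t ≤ ∑ i, (W (x i - ρ) + W (-x i - ρ)) + ε + M₀ * Real.exp (-κ * (t - 1)) := by
  have hn0 : (0 : ℝ) < n := by exact_mod_cast hn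
  set B : ℝ → ℝ := fun y => W (y - ρ) + W (-y - ρ) with hB
  set B' : ℝ → ℝ := fun y => W' (y - ρ) - W' (-y - ρ) with hB'
  set B'' : ℝ → ℝ := fun y => W'' (y - ρ) + W'' (-y - ρ) with hB''
  set z : ℝ → ℝ := fun τ => M₀ * Real.exp (-κ * (τ - 1)) with hz
  have hneg : ∀ y, |y| < ρ → y - ρ < 0 ∧ -y - ρ < 0 := fun y hy => by
    rw [abs_lt] at hy; constructor <;> linarith
  have hBd : ∀ y, |y| < ρ → HasDerivAt B (B' y) y := fun y hy => by
    have h1 := (hW _ (hneg y hy).1).2.1.comp y ((hasDerivAt_id y).sub_const ρ)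
    have h2 := (hW _ (hneg y hy).2).2.1.comp y ((hasDerivAt_id y).neg.sub_const ρ)
    exact (h1.add h2).congr_deriv (by simp only [hB']; ring)
  have hBdd : ∀ y, |y| < ρ → HasDerivAt B' (B'' y) y := fun y hy => by
    have h1 := (hW _ (hneg y hy).1).2.2.1.comp y ((hasDerivAt_id y).sub_const ρ)
    have h2 := (hW _ (hneg y hy).2).2.2.1.comp y ((hasDerivAt_id y).neg.sub_const ρ)
    exact (h1.sub h2).congr_deriv (by simp only [hB'']; ring)
  have hBpos : ∀ y, |y| < ρ → 0 < W (y - ρ) ∧ 0 < W (-y - ρ) := fun y hy =>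
    ⟨(hW _ (hneg y hy).1).1, (hW _ (hneg y hy).2).1⟩
  have hz0 : ∀ τ, 0 ≤ z τ := fun τ => by positivity
  by_contra! hlt
  obtain ⟨M, hM⟩ := ((isCompact_closedCube n ρ).prod
    (isCompact_Icc (a := (1 : ℝ)) (b := t))).bddAbove_image
    (hu_cont.mono fun q hq => ⟨mem_univ _, zero_lt_one.trans_le hq.2.1⟩)
  have hM' : ∀ y ∈ closedCube n ρ, ∀ τ ∈ Icc 1 t, u y τ ≤ M := fun y hy τ hτ =>
    hM ⟨(y, τ), ⟨hy, hτ⟩, rfl⟩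
  obtain ⟨y₀, hy₀, hy₀W⟩ := hWtop M
  set r := max (max (ρ + y₀) ‖WithLp.ofLp x‖) 0 with hr
  have hrρ : r < ρ := max_lt (max_lt (by linarith) ((pi_norm_lt_iff hρ).2 hx)) hρ
  have hxr : x ∈ closedCube n r := fun i =>
    (norm_le_pi_norm (WithLp.ofLp x) i).trans ((le_max_right _ _).trans (le_max_left _ _))
  have hcube : closedCube n r ⊆ closedCube n ρ := fun y hy i => (hy i).trans hrρ.le
  have hcont : ContinuousOn (fun q : Eucl n × ℝ => u q.1 q.2 - (∑ i, B (q.1 i)) - z q.2)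
      (closedCube n r ×ˢ Icc 1 t) := by
    refine ((hu_cont.mono fun q hq => ⟨mem_univ _, zero_lt_one.trans_le hq.2.1⟩).sub ?_).sub
      (by fun_prop)
    refine continuousOn_finsetSum _ fun i _ => ?_
    have h1 : ContinuousOn B (Icc (-r) r) := fun y hy =>
      (hBd y ((abs_le.2 hy).trans_lt hrρ)).continuousAt.continuousWithinAt
    exact h1.comp (f := fun q : Eucl n × ℝ => q.1 i) (by fun_prop) fun q hq => abs_le.1 (hq.1 i)
  obtain ⟨⟨p, τ⟩, ⟨hp, hτ⟩, hpmax⟩ :=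
    ((isCompact_closedCube n r).prod (isCompact_Icc (a := (1 : ℝ)) (b := t))).exists_isMaxOn
      ⟨(x, t), hxr, ht, le_rfl⟩ hcont
  have hmax : ∀ y ∈ closedCube n r, ∀ s ∈ Icc 1 t,
      u y s - (∑ i, B (y i)) - z s ≤ u p τ - (∑ i, B (p i)) - z τ := fun y hy s hs =>
    hpmax (show (y, s) ∈ closedCube n r ×ˢ Icc 1 t from ⟨hy, hs⟩)
  have hgt : ε < u p τ - (∑ i, B (p i)) - z τ := by
    have := hmax x hxr t ⟨ht, le_rfl⟩
    simp only [hB, hz] at this hlt ⊢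
    linarith
  have hpρ : ∀ i, |p i| < ρ := fun i => (hp i).trans_lt hrρ
  have hWle : ∀ i, W (p i - ρ) ≤ ∑ j, B (p j) ∧ W (-p i - ρ) ≤ ∑ j, B (p j) := fun i => by
    have h1 : B (p i) ≤ ∑ j, B (p j) := Finset.single_le_sum (f := fun j => B (p j))
      (fun j _ => (add_pos (hBpos _ (hpρ j)).1 (hBpos _ (hpρ j)).2).le) (Finset.mem_univ i)
    have h2 := hBpos _ (hpρ i)
    simp only [hB] at h1 ⊢
    constructor <;> linarith
  have hsum0 : 0 ≤ ∑ j, B (p j) := Finset.sum_nonneg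
    (fun j _ => (add_pos (hBpos _ (hpρ j)).1 (hBpos _ (hpρ j)).2).le)
  have hupM := hM' p (hcube hp) τ hτ
  have hpr : ∀ i, |p i| < r := fun i => by
    refine lt_of_le_of_ne (hp i) fun heq => ?_
    have hy₀r : ρ + y₀ ≤ r := (le_max_left _ _).trans (le_max_left _ _)
    have h1 := hWle i
    have h2 : M ≤ ∑ j, B (p j) := by
      rcases abs_choice (p i) with h | h
      · exact (hy₀W _ (by linarith) (by linarith)).trans h1.1
      · exact (hy₀W _ (by linarith) (by linarith)).trans h1.2
    linarith [hz0 τ]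
  have hτ1 : 1 < τ := by
    refine lt_of_le_of_ne hτ.1 fun heq => ?_
    have h1 := hinit p (hcube hp)
    have h2 : z τ = M₀ := by simp [hz, ← heq]
    rw [← heq] at hgt h2
    linarith
  have hτ0 : 0 < τ := by linarith
  set V := (∑ i, B (p i)) + ε with hV
  have hV0 : 0 < V := by linarith
  have huV : V ≤ u p τ := by linarith [hz0 τ]
  have hψV := hψ_pos V hV0
  have hspace := gradient_hessian_at_max (v := fun y => u y τ) (dv := fun y => du y τ)
    (d2v := fun y => d2u y τ) (fun y => hdu y τ hτ0) (fun y => hd2u y τ hτ0)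
    (fun y hy => hBd y (hy.trans hrρ)) (fun y hy => hBdd y (hy.trans hrρ)) hpr
    (fun y hy => by linarith [hmax y hy τ hτ])
  have hzd : HasDerivAt z (-κ * z τ) τ := by
    have h1 := ((((hasDerivAt_id τ).sub_const 1).const_mul (-κ)).exp).const_mul M₀
    exact h1.congr_deriv (by simp only [hz, id]; ring)
  have htime : -κ * z τ ≤ ut p τ := by
    have h1 := deriv_nonneg_of_forall_le_left hτ1 ((hut p τ hτ0).sub hzd) fun s hs => by
      have := hmax p hp s ⟨hs.1, hs.2.trans hτ.2⟩
      simp only [Pi.sub_apply]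
      linarith
    linarith
  have hzM : κ * z τ ≤ ψ V / 4 := by
    have h1 : z τ ≤ M₀ := mul_le_of_le_one_right hM₀
      (Real.exp_le_one_iff.2 (by nlinarith))
    have h2 := hψ_mono ε V hε (by linarith)
    nlinarith
  have hψW : ∀ y, y < 0 → W y ≤ ∑ j, B (p j) → ψ (W y + ε) ≤ ψ V := fun y hy hyW =>
    hψ_mono _ _ (by linarith [(hW y hy).1]) (by linarith)
  have hinv_mono := monotoneOn_of_invOn hφ_mono hφ_bij hφinv
  have hW'le : ∀ y, y < 0 → W y ≤ ∑ j, B (p j) → W' y ≤ φinv (ψ V / 4) / n := fun y hy hyW => by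
    have h1 := hψW y hy hyW
    have h2 := hψ_pos (W y + ε) (by linarith [(hW y hy).1])
    refine (hW y hy).2.2.2.2.1.trans (div_le_div_of_nonneg_right (hinv_mono ?_ ?_ ?_) hn0.le)
    · simp only [mem_Ici]; linarith
    · simp only [mem_Ici]; linarith
    · linarith
  have hgrad : φ ‖du p τ‖ ≤ ψ V / 4 := by
    have h1 : ‖du p τ‖ ≤ φinv (ψ V / 4) := by
      calc ‖du p τ‖ ≤ ∑ i, |du p τ i| := eucl_norm_le_sum _
        _ ≤ ∑ _i : Fin n, φinv (ψ V / 4) / n := by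
          refine Finset.sum_le_sum fun i _ => ?_
          rw [(hspace i).1]
          have h2 := hneg _ (hpρ i)
          have h3 := hW'le _ h2.1 (hWle i).1
          have h4 := hW'le _ h2.2 (hWle i).2
          have h5 := (hW _ h2.1).2.2.2.1
          have h6 := (hW _ h2.2).2.2.2.1
          rw [abs_le]
          constructor <;> simp only [hB'] <;> linarith
        _ = φinv (ψ V / 4) := by
          rw [Finset.sum_const, Finset.card_univ, Fintype.card_fin, nsmul_eq_mul]
          field_simp
    exact (hφ_mono _ _ (norm_nonneg _) h1).trans_eq (hφinv.2 (by simp only [mem_Ici]; linarith))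
  have hlap : ∑ i, d2u p τ i i ≤ ψ V / 4 := by
    calc ∑ i, d2u p τ i i ≤ ∑ _i : Fin n, ψ V / 4 / n := by
          refine Finset.sum_le_sum fun i _ => (hspace i).2.trans ?_
          have h2 := hneg _ (hpρ i)
          have h3 := (hW _ h2.1).2.2.2.2.2.trans
            (div_le_div_of_nonneg_right (hψW _ h2.1 (hWle i).1) (by positivity))
          have h4 := (hW _ h2.2).2.2.2.2.2.trans
            (div_le_div_of_nonneg_right (hψW _ h2.2 (hWle i).2) (by positivity))
          have h5 : ψ V / 4 / n = ψ V / (8 * n) + ψ V / (8 * n) := by field_simp; norm_num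
          rw [h5]
          exact add_le_add h3 h4
      _ = ψ V / 4 := by
          rw [Finset.sum_const, Finset.card_univ, Fintype.card_fin, nsmul_eq_mul]
          field_simp
  have hfin := hsub p τ hτ0 (by linarith)
  have := hψ_mono V _ hV0 huV
  linarith

/-- A subsolution is eventually at most `δ` on every cube. -/
theorem eventually_le_of_subsolution_s6 {n : ℕ} (hn : 1 ≤ n) {φ ψ φinv : ℝ → ℝ}
    (hφ_mono : ∀ s t : ℝ, 0 ≤ s → s ≤ t → φ s ≤ φ t)
    (hφ_bij : BijOn φ (Ici 0) (Ici 0)) (hφinv : InvOn φinv φ (Ici 0) (Ici 0))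
    (hψ_mono : ∀ s t : ℝ, 0 < s → s ≤ t → ψ s ≤ ψ t)
    (hψ_cont : ContinuousOn ψ (Ioi 0)) (hψ_pos : ∀ s : ℝ, 0 < s → 0 < ψ s)
    (hliminf : 0 < liminf (fun ζ : ℝ => φinv ζ / φinv (2 * ζ)) atTop)
    (hint₁ : IntegrableOn (fun ζ : ℝ => (Real.sqrt (ψ ζ * ζ))⁻¹) (Ioi 1))
    (hint₂ : IntegrableOn (fun ζ : ℝ => (φinv (ψ ζ))⁻¹) (Ioi 1))
    {u : Eucl n → ℝ → ℝ} {du : Eucl n → ℝ → Eucl n} {d2u : Eucl n → ℝ → Fin n → Fin n → ℝ}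
    {ut : Eucl n → ℝ → ℝ}
    (hdu : ∀ (x : Eucl n) (t : ℝ), 0 < t → ∀ i,
      HasDerivAt (fun s : ℝ => u (x + s • EuclideanSpace.single i (1 : ℝ)) t) (du x t i) 0)
    (hd2u : ∀ (x : Eucl n) (t : ℝ), 0 < t → ∀ i j,
      HasDerivAt (fun s : ℝ => du (x + s • EuclideanSpace.single j (1 : ℝ)) t i) (d2u x t i j) 0)
    (hut : ∀ (x : Eucl n) (t : ℝ), 0 < t → HasDerivAt (fun τ : ℝ => u x τ) (ut x t) t)
    (hu_cont : ContinuousOn (fun q : Eucl n × ℝ => u q.1 q.2) (univ ×ˢ Ioi 0))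
    (hsub : ∀ (x : Eucl n) (t : ℝ), 0 < t → 0 < u x t →
      ut x t ≤ (∑ i, d2u x t i i) + φ ‖du x t‖ - ψ (u x t))
    (R : ℝ) {δ : ℝ} (hδ : 0 < δ) :
    ∀ᶠ t in atTop, ∀ x ∈ closedCube n R, u x t ≤ δ := by
  have hn0 : (0 : ℝ) < n := by exact_mod_cast hn
  have hε : 0 < δ / 3 := by positivity
  obtain ⟨W, W', W'', hW, hWtop, hWzero⟩ := exists_barrier_s6 hn hφ_mono hφ_bij hφinv hψ_mono hψ_cont
    hψ_pos hliminf hint₁ hint₂ hε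
  obtain ⟨y₀, hy₀, hy₀W⟩ := hWzero (δ / (6 * n)) (by positivity)
  set ρ := |R| - y₀ with hρ
  have hρ0 : 0 < ρ := by linarith [abs_nonneg R]
  obtain ⟨M, hM⟩ := (isCompact_closedCube n ρ).bddAbove_image (f := fun x => u x 1)
    (hu_cont.comp (f := fun x : Eucl n => (x, (1 : ℝ))) (by fun_prop)
      fun x _ => ⟨mem_univ _, zero_lt_one (α := ℝ)⟩)
  set M₀ := max M 1 with hM₀
  have hM₀1 : 1 ≤ M₀ := le_max_right _ _
  have hψε := hψ_pos _ hε
  set κ := ψ (δ / 3) / 4 / M₀ with hκ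
  have hκ0 : 0 < κ := by positivity
  have hlim : Tendsto (fun t : ℝ => M₀ * Real.exp (-κ * (t - 1))) atTop (nhds (M₀ * 0)) := by
    refine (Real.tendsto_exp_atBot.comp ?_).const_mul M₀
    exact (tendsto_atTop_add_const_right atTop (-1 : ℝ) tendsto_id).const_mul_atTop_of_neg
      (neg_lt_zero.2 hκ0)
  rw [mul_zero] at hlim
  filter_upwards [hlim.eventually (gt_mem_nhds hε), eventually_ge_atTop 1] with t hzt ht x hx
  have hxR : ∀ i, |x i| ≤ |R| := fun i => (hx i).trans (le_abs_self R)
  have h1 := le_barrier hn hφ_mono hφ_bij hφinv hψ_mono hψ_pos hdu hd2u hut hu_cont hsub hε hW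
    hWtop hρ0 (by linarith) hκ0.le (by rw [hκ, div_mul_cancel₀ _ (by linarith)])
    (fun x hx => (hM ⟨x, hx, rfl⟩).trans (le_max_left _ _)) ht
    (x := x) (fun i => by linarith [hxR i])
  have h2 : ∑ i, (W (x i - ρ) + W (-x i - ρ)) ≤ ∑ _i : Fin n, δ / 3 / n := by
    refine Finset.sum_le_sum fun i _ => ?_
    have h3 := abs_le.1 (hxR i)
    have h4 := hy₀W (x i - ρ) (by linarith)
    have h5 := hy₀W (-x i - ρ) (by linarith)
    have h6 : δ / 3 / n = δ / (6 * n) + δ / (6 * n) := by field_simp; norm_num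
    linarith
  rw [Finset.sum_const, Finset.card_univ, Fintype.card_fin, nsmul_eq_mul,
    mul_div_cancel₀ _ hn0.ne'] at h2
  linarith

/-- **Example 2.4.** For `u_t = Δu + b(x,Du) − c(x,u)` in `ℝⁿ × (0,∞)` with
`|b(x,ξ)| ≤ φ(|ξ|)`, `c(x,ζ)·sign ζ ≥ ψ(|ζ|)`, where `φ, ψ` are non-decreasing
continuous, `φ` a bijection of `[0,∞)` onto itself with
`liminf_{ζ→∞} φ⁻¹(ζ)/φ⁻¹(2ζ) > 0`, if `∫₁^∞ (ψ(ζ)ζ)^{-1/2} dζ < ∞` and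
`∫₁^∞ dζ/(φ⁻¹∘ψ)(ζ) < ∞`, then every classical solution stabilizes to zero
uniformly on every compact subset of `ℝⁿ` as `t → ∞`. -/
theorem example_2_4_stabilization
    (n : ℕ) (hn : 1 ≤ n)
    (b : Eucl n → Eucl n → ℝ) (c : Eucl n → ℝ → ℝ)
    (φ ψ φinv : ℝ → ℝ)
    (hφ_mono : ∀ s t : ℝ, 0 ≤ s → s ≤ t → φ s ≤ φ t)
    (hφ_cont : ContinuousOn φ (Ici 0))
    (hφ_bij : BijOn φ (Ici 0) (Ici 0))
    (hφinv : InvOn φinv φ (Ici 0) (Ici 0))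
    (hψ_mono : ∀ s t : ℝ, 0 < s → s ≤ t → ψ s ≤ ψ t)
    (hψ_cont : ContinuousOn ψ (Ioi 0))
    (hψ_pos : ∀ s : ℝ, 0 < s → 0 < ψ s)
    (hliminf : 0 < liminf (fun ζ : ℝ => φinv ζ / φinv (2 * ζ)) atTop)
    (hb : ∀ (x : Eucl n) (ξ : Eucl n), |b x ξ| ≤ φ ‖ξ‖)
    (hc : ∀ (x : Eucl n) (ζ : ℝ), ζ ≠ 0 → ψ |ζ| ≤ c x ζ * Real.sign ζ)
    (hint₁ : IntegrableOn (fun ζ : ℝ => (Real.sqrt (ψ ζ * ζ))⁻¹) (Ioi 1))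
    (hint₂ : IntegrableOn (fun ζ : ℝ => (φinv (ψ ζ))⁻¹) (Ioi 1))
    -- `u` is a classical solution
    (u : Eucl n → ℝ → ℝ) (du : Eucl n → ℝ → Eucl n)
    (d2u : Eucl n → ℝ → Fin n → Fin n → ℝ) (ut : Eucl n → ℝ → ℝ)
    (hdu : ∀ (x : Eucl n) (t : ℝ), 0 < t → ∀ i,
      HasDerivAt (fun s : ℝ => u (x + s • EuclideanSpace.single i (1 : ℝ)) t) (du x t i) 0)
    (hd2u : ∀ (x : Eucl n) (t : ℝ), 0 < t → ∀ i j,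
      HasDerivAt (fun s : ℝ => du (x + s • EuclideanSpace.single j (1 : ℝ)) t i) (d2u x t i j) 0)
    (hut : ∀ (x : Eucl n) (t : ℝ), 0 < t → HasDerivAt (fun τ : ℝ => u x τ) (ut x t) t)
    (hu_cont : ContinuousOn (fun q : Eucl n × ℝ => u q.1 q.2) (univ ×ˢ Ioi 0))
    (hdu_cont : ∀ i, ContinuousOn (fun q : Eucl n × ℝ => du q.1 q.2 i) (univ ×ˢ Ioi 0))
    (hd2u_cont : ∀ i j, ContinuousOn (fun q : Eucl n × ℝ => d2u q.1 q.2 i j) (univ ×ˢ Ioi 0))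
    (hut_cont : ContinuousOn (fun q : Eucl n × ℝ => ut q.1 q.2) (univ ×ˢ Ioi 0))
    -- the equation `u_t = Δu + b(x,Du) − c(x,u)`
    (heq : ∀ (x : Eucl n) (t : ℝ), 0 < t →
      ut x t = (∑ i, d2u x t i i) + b x (du x t) - c x (u x t)) :
    ∀ K : Set (Eucl n), IsCompact K →
      Tendsto (fun t : ℝ => sSup ((fun x => |u x t|) '' K)) atTop (nhds 0) := by
  intro K hK
  have key := eventually_le_of_subsolution_s6 hn hφ_mono hφ_bij hφinv hψ_mono hψ_cont hψ_pos hliminf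
    hint₁ hint₂ hdu hd2u hut hu_cont (fun x t ht hu => by
      have h1 := hc x (u x t) hu.ne'
      rw [Real.sign_of_pos hu, abs_of_pos hu, mul_one] at h1
      have h2 := (abs_le.1 (hb x (du x t))).2
      linarith [heq x t ht])
  have key_neg := eventually_le_of_subsolution_s6 hn hφ_mono hφ_bij hφinv hψ_mono hψ_cont hψ_pos
    hliminf hint₁ hint₂ (u := fun x t => -u x t) (du := fun x t => -du x t)
    (d2u := fun x t i j => -d2u x t i j) (ut := fun x t => -ut x t)
    (fun x t ht i => (hdu x t ht i).neg) (fun x t ht i j => (hd2u x t ht i j).neg)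
    (fun x t ht => (hut x t ht).neg) hu_cont.neg (fun x t ht hu => by
      have hu' : u x t < 0 := neg_pos.1 hu
      have h1 := hc x (u x t) hu'.ne
      rw [Real.sign_of_neg hu', abs_of_neg hu'] at h1
      have h2 := (abs_le.1 (hb x (du x t))).1
      rw [norm_neg, Finset.sum_neg_distrib]
      linarith [heq x t ht])
  obtain ⟨R, hR⟩ := hK.isBounded.exists_norm_le
  have hKR : K ⊆ closedCube n R := fun x hx i => (PiLp.norm_apply_le x i).trans (hR x hx)
  refine Metric.tendsto_nhds.2 fun δ hδ => ?_
  filter_upwards [key R (half_pos hδ), key_neg R (half_pos hδ)] with t h1 h2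
  have h3 : sSup ((fun x => |u x t|) '' K) ≤ δ / 2 := Real.sSup_le (by
    rintro _ ⟨x, hx, rfl⟩
    exact abs_le.2 ⟨by linarith [h2 x (hKR hx)], h1 x (hKR hx)⟩) (by linarith)
  have h4 : 0 ≤ sSup ((fun x => |u x t|) '' K) := Real.sSup_nonneg (by
    rintro _ ⟨x, hx, rfl⟩
    exact abs_nonneg _)
  rw [Real.dist_eq, sub_zero, abs_of_nonneg h4]
  linarith
end
end

section
/- Let u be a classical solution of the inequality ∂u/∂t − Σ_{i,j=1}^n a_{ij}(x,u) ∂²u/∂x_i∂x_j + f(x,u,Du) ≤ 0 in ℝ₊^{n+1}, under the structural assumptions on a_{ij}, f, g, h, p. There exists a constant C > 0, depending only on n, with the following property: whenever 0 < r₁ < r₂ and 0 < τ₁ < τ₂ < τ are real numbers with M₁ := sup_{Q_{r₁}^{τ−τ₁,τ}} u > 0, then, setting M₂ := sup_{Q_{r₂}^{τ−τ₂,τ}} u, at least one of the following three estimates holds: (i) M₂ − M₁ ≥ C (r₂−r₁)² q(r₂) lim_{μ→M₁−0} inf_{[μ,M₂]} g; (ii) M₂ − M₁ ≥ C (r₂−r₁)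 r₂ q(r₂) lim_{μ→M₁−0} inf_{[μ,M₂]} h; (iii) M₂ − M₁ ≥ C (τ₂−τ₁) q(r₂) lim_{μ→M₁−0} inf_{[μ,M₂]} g. -/
open Set Filter MeasureTheory Metric

noncomputable section

/-- The increment of `f` in the `i`-th coordinate direction, based at a moving point `y v`. -/
lemma isLittleO_partial_increment {n : ℕ} {f : Eucl n → ℝ} {D : Eucl n → ℝ} {i : Fin n}
    (hf : ∀ x, HasDerivAt (fun s : ℝ => f (x + s • EuclideanSpace.single i (1 : ℝ))) (D x) 0)
    {x : Eucl n} (hD : ContinuousAt D x) {y : Eucl n → Eucl n}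
    (hy : Tendsto y (nhds 0) (nhds x)) :
    (fun v : Eucl n => f (y v + v i • EuclideanSpace.single i (1 : ℝ)) - f (y v) - D x * v i)
      =o[nhds 0] fun v => v := by
  refine Asymptotics.isLittleO_iff.mpr fun ε hε => ?_
  obtain ⟨δ, hδ, hball⟩ := Metric.continuousAt_iff.mp hD ε hε
  filter_upwards [hy (ball_mem_nhds x (half_pos hδ)), ball_mem_nhds 0 (half_pos hδ)] with v hyv hv
  have hv' : ‖v‖ < δ / 2 := by simpa using hv
  have hvi : ‖v i‖ ≤ ‖v‖ := PiLp.norm_apply_le v i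
  have hderiv : ∀ s ∈ closedBall (0 : ℝ) ‖v i‖, HasDerivWithinAt
      (fun s : ℝ => f (y v + s • EuclideanSpace.single i (1 : ℝ)) - D x * s)
      (D (y v + s • EuclideanSpace.single i (1 : ℝ)) - D x) (closedBall (0 : ℝ) ‖v i‖) s := by
    intro s _
    have h1 := hf (y v + s • EuclideanSpace.single i (1 : ℝ))
    rw [← sub_self s] at h1
    have h2 := h1.comp_sub_const s s
    simp only [add_assoc, ← add_smul, add_sub_cancel] at h2
    exact (h2.sub (by simpa using (hasDerivAt_id s).const_mul (D x))).hasDerivWithinAt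
  have hbound : ∀ s ∈ closedBall (0 : ℝ) ‖v i‖,
      ‖D (y v + s • EuclideanSpace.single i (1 : ℝ)) - D x‖ ≤ ε := by
    intro s hs
    rw [← dist_eq_norm]
    refine (hball ?_).le
    have h1 : ‖s‖ ≤ ‖v i‖ := by simpa using hs
    have h2 : dist (y v) x < δ / 2 := hyv
    rw [dist_eq_norm] at h2 ⊢
    calc ‖y v + s • EuclideanSpace.single i (1 : ℝ) - x‖
        = ‖(y v - x) + s • EuclideanSpace.single i (1 : ℝ)‖ := by congr 1; abel
      _ ≤ ‖y v - x‖ + ‖s • EuclideanSpace.single i (1 : ℝ)‖ := norm_add_le _ _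
      _ < δ := by
        rw [norm_smul]
        simp only [PiLp.norm_single, norm_one, mul_one]
        linarith
  have := (convex_closedBall (0 : ℝ) ‖v i‖).norm_image_sub_le_of_norm_hasDerivWithin_le hderiv
    hbound (x := 0) (y := v i) (by simp) (by simp)
  simp only [zero_smul, add_zero, mul_zero, sub_zero] at this
  rw [sub_right_comm]
  exact this.trans (mul_le_mul_of_nonneg_left hvi hε.le)

/-- A function on Euclidean space with continuous partial derivatives is differentiable. -/
lemma hasFDerivAt_of_continuous_partials {n : ℕ} {f : Eucl n → ℝ} {D : Eucl n → Fin n → ℝ}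
    (hf : ∀ x i, HasDerivAt (fun s : ℝ => f (x + s • EuclideanSpace.single i (1 : ℝ))) (D x i) 0)
    (hD : ∀ i, Continuous fun x => D x i) (x : Eucl n) :
    HasFDerivAt f (∑ i, D x i • (EuclideanSpace.proj i : Eucl n →L[ℝ] ℝ)) x := by
  have main : ∀ S : Finset (Fin n),
      (fun v : Eucl n => f (x + ∑ i ∈ S, v i • EuclideanSpace.single i (1 : ℝ)) - f x
        - ∑ i ∈ S, D x i * v i) =o[nhds 0] fun v => v := by
    intro S
    induction S using Finset.induction_on with
    | empty => simp
    | insert i S hi ih =>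
      have hy : Tendsto (fun v : Eucl n => x + ∑ i ∈ S, v i • EuclideanSpace.single i (1 : ℝ))
          (nhds 0) (nhds x) := by
        have : Continuous fun v : Eucl n =>
            x + ∑ i ∈ S, v i • EuclideanSpace.single i (1 : ℝ) := by fun_prop
        simpa using this.tendsto 0
      refine ((isLittleO_partial_increment (fun x => hf x i) (hD i).continuousAt hy).add ih).congr_left
        fun v => ?_
      simp only [Finset.sum_insert hi, add_comm (v i • _), ← add_assoc]
      ring
  rw [hasFDerivAt_iff_isLittleO_nhds_zero]
  refine (main Finset.univ).congr_left fun v => ?_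
  have hv : ∑ i, v i • EuclideanSpace.single i (1 : ℝ) = v := by
    simpa using (EuclideanSpace.basisFun (Fin n) ℝ).sum_repr v
  rw [hv]
  simp

/-- A nonnegative quadratic form contracts nonnegatively with a positive semidefinite symmetric
matrix. -/
lemma sum_mul_nonneg_of_quadratic_nonneg {n : ℕ} {A S : Fin n → Fin n → ℝ}
    (hA : ∀ ξ : Fin n → ℝ, 0 ≤ ∑ i, ∑ j, A i j * ξ i * ξ j)
    (hsymm : ∀ i j, S i j = S j i)
    (hS : ∀ ξ : Fin n → ℝ, 0 ≤ ∑ i, ∑ j, S i j * ξ i * ξ j) :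
    0 ≤ ∑ i, ∑ j, A i j * S i j := by
  have hpsd : (Matrix.of S).PosSemidef := by
    refine Matrix.PosSemidef.of_dotProduct_mulVec_nonneg ?_ fun ξ => ?_
    · ext i j
      simp [hsymm i j]
    · refine (hS ξ).trans_eq ?_
      simp only [dotProduct, Matrix.mulVec, Finset.mul_sum, Matrix.of_apply, star_trivial]
      exact Finset.sum_congr rfl fun i _ => Finset.sum_congr rfl fun j _ => by ring
  obtain ⟨m, v, hv⟩ := Matrix.posSemidef_iff_eq_sum_vecMulVec.mp hpsd
  have hS' : ∀ i j, S i j = ∑ k, v k i * v k j := fun i j => by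
    have := congrFun (congrFun hv i) j
    simpa [Matrix.sum_apply, Matrix.vecMulVec_apply] using this
  have : ∑ i, ∑ j, A i j * S i j = ∑ k, ∑ i, ∑ j, A i j * v k i * v k j := by
    simp only [hS', Finset.mul_sum, mul_assoc]
    rw [Finset.sum_comm]
    conv_rhs => rw [Finset.sum_comm]; enter [2, i]; rw [Finset.sum_comm]
    rw [Finset.sum_comm]
  rw [this]
  exact Finset.sum_nonneg fun k _ => hA (v k)

/-- At a local maximum the second derivative is nonpositive. -/
lemma IsLocalMax.second_deriv_nonpos_s9 {φ φ' : ℝ → ℝ} {d x : ℝ} (h : IsLocalMax φ x)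
    (h1 : ∀ s, HasDerivAt φ (φ' s) s) (h2 : HasDerivAt φ' d x) : d ≤ 0 := by
  by_contra! hd
  have e1 : deriv φ = φ' := funext fun s => (h1 s).deriv
  have hmin : IsLocalMin φ x :=
    isLocalMin_of_deriv_deriv_pos (by rwa [e1, h2.deriv]) h.deriv_eq_zero (h1 x).continuousAt
  have hconst : φ =ᶠ[nhds x] fun _ => φ x := by
    filter_upwards [h, hmin] with s hs hs' using le_antisymm hs hs'
  have : deriv (deriv φ) x = 0 := by
    rw [(hconst.deriv).deriv_eq]
    simp
  rw [e1, h2.deriv] at this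
  exact hd.ne' this

/-- First- and second-order conditions for touching from above by the square of a quadratic
polynomial. -/
lemma deriv_conditions_of_le_sq_quadratic {φ φ' : ℝ → ℝ} {d k σ b c : ℝ}
    (h1 : ∀ s, HasDerivAt φ (φ' s) s) (h2 : HasDerivAt φ' d 0)
    (hle : ∀ᶠ s in nhds (0 : ℝ), φ s ≤ φ 0 + k * ((σ + b * s + c * s ^ 2) ^ 2 - σ ^ 2)) :
    φ' 0 = k * (2 * σ * b) ∧ d ≤ k * (2 * b ^ 2 + 4 * σ * c) := by
  have hq : ∀ s : ℝ, HasDerivAt (fun s => σ + b * s + c * s ^ 2) (b + 2 * c * s) s := fun s => by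
    have := (((hasDerivAt_id s).const_mul b).const_add σ).add (((hasDerivAt_id s).pow 2).const_mul c)
    refine this.congr_deriv ?_
    simp; ring
  have hl : ∀ s : ℝ, HasDerivAt (fun s => b + 2 * c * s) (2 * c) s := fun s => by
    refine (((hasDerivAt_id s).const_mul (2 * c)).const_add b).congr_deriv ?_
    simp
  have hψ : ∀ s, HasDerivAt (fun s => φ s - k * (σ + b * s + c * s ^ 2) ^ 2)
      (φ' s - k * (2 * ((σ + b * s + c * s ^ 2) * (b + 2 * c * s)))) s := fun s => by
    refine ((h1 s).sub (((hq s).pow 2).const_mul k)).congr_deriv ?_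
    norm_num; left; ring
  have hψ' := h2.sub ((((hq 0).mul (hl 0)).const_mul 2).const_mul k)
  have hmax : IsLocalMax (fun s => φ s - k * (σ + b * s + c * s ^ 2) ^ 2) 0 := by
    filter_upwards [hle] with s hs
    simp only [mul_zero, ne_eq, OfNat.ofNat_ne_zero, not_false_eq_true, zero_pow, add_zero]
    linarith
  have e1 := hmax.hasDerivAt_eq_zero (hψ 0)
  have e2 := hmax.second_deriv_nonpos_s9 hψ hψ'
  simp at e1 e2
  constructor <;> linarith

/-- First- and second-order conditions at a point where a `C²` function is touched from above by
the square of a quadratic polynomial in `‖x‖`. -/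
lemma conditions_of_touching_radial {n : ℕ} {v : Eucl n → ℝ} {dv : Eucl n → Eucl n}
    {d2v : Eucl n → Fin n → Fin n → ℝ}
    (hv : ∀ x i, HasDerivAt (fun s : ℝ => v (x + s • EuclideanSpace.single i (1 : ℝ))) (dv x i) 0)
    (hdv : ∀ x i j,
      HasDerivAt (fun s : ℝ => dv (x + s • EuclideanSpace.single j (1 : ℝ)) i) (d2v x i j) 0)
    (cdv : ∀ i, Continuous fun x => dv x i) (cd2v : ∀ i j, Continuous fun x => d2v x i j)
    {x₀ : Eucl n} {k σ : ℝ}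
    (hle : ∀ᶠ x in nhds x₀, v x ≤ v x₀ + k * ((σ + (‖x‖ ^ 2 - ‖x₀‖ ^ 2)) ^ 2 - σ ^ 2))
    {A : Fin n → Fin n → ℝ} (hA : ∀ ξ : Fin n → ℝ, 0 ≤ ∑ i, ∑ j, A i j * ξ i * ξ j) :
    dv x₀ = (4 * k * σ) • x₀ ∧
      ∑ i, ∑ j, A i j * d2v x₀ i j ≤
        ∑ i, ∑ j, A i j * (k * (8 * (x₀ i * x₀ j) + if i = j then 4 * σ else 0)) := by
  have F1 := hasFDerivAt_of_continuous_partials hv cdv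
  have F2 := fun i => hasFDerivAt_of_continuous_partials (f := fun x => dv x i)
    (fun x j => hdv x i j) (cd2v i)
  have hline : ∀ (ξ : Eucl n) (s : ℝ), HasDerivAt (fun s : ℝ => x₀ + s • ξ) ξ s := fun ξ s => by
    simpa using ((hasDerivAt_id s).smul_const ξ).const_add x₀
  have hcond : ∀ ξ : Eucl n, (∑ i, dv x₀ i * ξ i) = k * (2 * σ * (2 * inner ℝ x₀ ξ)) ∧
      (∑ i, (∑ j, d2v x₀ i j * ξ j) * ξ i) ≤
        k * (2 * (2 * inner ℝ x₀ ξ) ^ 2 + 4 * σ * ‖ξ‖ ^ 2) := by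
    intro ξ
    have h1 : ∀ s, HasDerivAt (fun s : ℝ => v (x₀ + s • ξ)) (∑ i, dv (x₀ + s • ξ) i * ξ i) s :=
      fun s => by simpa [Function.comp_def] using (F1 (x₀ + s • ξ)).comp_hasDerivAt s (hline ξ s)
    have h2 : HasDerivAt (fun s : ℝ => ∑ i, dv (x₀ + s • ξ) i * ξ i)
        (∑ i, (∑ j, d2v x₀ i j * ξ j) * ξ i) 0 := by
      refine HasDerivAt.fun_sum fun i _ => HasDerivAt.mul_const ?_ _
      simpa [Function.comp_def] using (F2 i (x₀ + (0 : ℝ) • ξ)).comp_hasDerivAt 0 (hline ξ 0)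
    have ht : Tendsto (fun s : ℝ => x₀ + s • ξ) (nhds 0) (nhds x₀) := by
      simpa using (hline ξ 0).continuousAt.tendsto
    have := deriv_conditions_of_le_sq_quadratic (k := k) (σ := σ) (b := 2 * inner ℝ x₀ ξ)
      (c := ‖ξ‖ ^ 2) h1 h2 (by
        filter_upwards [ht.eventually hle] with s hs
        have e : ‖x₀ + s • ξ‖ ^ 2 = ‖x₀‖ ^ 2 + 2 * (s * inner ℝ x₀ ξ) + s ^ 2 * ‖ξ‖ ^ 2 := by
          rw [norm_add_sq_real, inner_smul_right, norm_smul, mul_pow, Real.norm_eq_abs, sq_abs]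
        simp only [zero_smul, add_zero]
        rw [e] at hs
        refine hs.trans_eq ?_
        ring)
    simpa using this
  have hsymm : ∀ i j, d2v x₀ i j = d2v x₀ j i := by
    intro i j
    have hF' : HasFDerivAt (fun x => ∑ i, dv x i • (EuclideanSpace.proj i : Eucl n →L[ℝ] ℝ))
        (∑ i, (∑ j, d2v x₀ i j • (EuclideanSpace.proj j : Eucl n →L[ℝ] ℝ)).smulRight
          (EuclideanSpace.proj i : Eucl n →L[ℝ] ℝ)) x₀ :=
      HasFDerivAt.fun_sum fun i _ =>
        (F2 i x₀).smul_const (EuclideanSpace.proj i : Eucl n →L[ℝ] ℝ)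
    have := second_derivative_symmetric F1 hF' (EuclideanSpace.single j 1)
      (EuclideanSpace.single i 1)
    simpa [Pi.single_apply] using this
  refine ⟨?_, ?_⟩
  · ext i
    have := (hcond (EuclideanSpace.single i 1)).1
    simp [EuclideanSpace.inner_single_right] at this
    simp only [PiLp.smul_apply, smul_eq_mul]
    linarith
  · rw [← sub_nonneg, ← Finset.sum_sub_distrib]
    simp only [← Finset.sum_sub_distrib, ← mul_sub]
    refine sum_mul_nonneg_of_quadratic_nonneg hA (fun i j => ?_) fun ξ => ?_
    · rw [hsymm i j, mul_comm (x₀ i)]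
      simp only [eq_comm]
    · have h := (hcond (WithLp.toLp 2 ξ)).2
      rw [EuclideanSpace.real_norm_sq_eq] at h
      simp only [PiLp.inner_apply, RCLike.inner_apply, conj_trivial] at h
      have e1 : (∑ i, ξ i * x₀ i) ^ 2 = ∑ i, ∑ j, x₀ i * x₀ j * ξ i * ξ j := by
        rw [sq, Finset.sum_mul_sum]
        exact Finset.sum_congr rfl fun i _ => Finset.sum_congr rfl fun j _ => by ring
      have e2 : ∑ i, ξ i ^ 2 = ∑ i, ∑ j, (if i = j then 1 else 0) * ξ i * ξ j := by
        simp [sq]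
      have e3 : ∑ i, (∑ j, d2v x₀ i j * ξ j) * ξ i = ∑ i, ∑ j, d2v x₀ i j * ξ i * ξ j := by
        simp only [Finset.sum_mul]
        exact Finset.sum_congr rfl fun i _ => Finset.sum_congr rfl fun j _ => by ring
      have e4 : ∑ i, ∑ j, (k * (8 * (x₀ i * x₀ j) + if i = j then 4 * σ else 0) - d2v x₀ i j)
          * ξ i * ξ j = k * 8 * (∑ i, ∑ j, x₀ i * x₀ j * ξ i * ξ j)
            + k * (4 * σ) * (∑ i, ∑ j, (if i = j then 1 else 0) * ξ i * ξ j)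
            - ∑ i, ∑ j, d2v x₀ i j * ξ i * ξ j := by
        simp only [Finset.mul_sum, ← Finset.sum_add_distrib, ← Finset.sum_sub_distrib]
        refine Finset.sum_congr rfl fun i _ => Finset.sum_congr rfl fun j _ => ?_
        split_ifs <;> ring
      rw [e4, ← e1, ← e2, ← e3]
      linarith

lemma sq_max_le (y z : ℝ) : max y 0 ^ 2 ≤ (max z 0 + (y - z)) ^ 2 := by
  rcases le_total y 0 with hy | hy
  · rw [max_eq_right hy]
    nlinarith [sq_nonneg (max z 0 + (y - z))]
  · rw [max_eq_left hy]
    exact pow_le_pow_left₀ hy (by linarith [le_max_left z 0]) 2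

/-- A barrier argument: subtracting a truncated barrier that exceeds `M₂ - M₁` on the parabolic
boundary of the large cylinder, the maximum is attained off that boundary. -/
lemma exists_touching_point {n : ℕ} {U : Eucl n → ℝ → ℝ} {r₁ r₂ T₀ T₁ T M₁ M₂ K k l : ℝ}
    (hU : ContinuousOn (fun q : Eucl n × ℝ => U q.1 q.2) (closedBall 0 r₂ ×ˢ Icc T₀ T))
    (hr₁ : 0 < r₁) (hr : r₁ < r₂) (hT₀ : T₀ < T₁) (hT : T₁ < T)
    (hM₂ : ∀ x ∈ closedBall (0 : Eucl n) r₂, ∀ t ∈ Icc T₀ T, U x t ≤ M₂)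
    (hM₁ : ∀ c, (∀ x ∈ ball (0 : Eucl n) r₁, ∀ t ∈ Ioo T₁ T, U x t ≤ c) → M₁ ≤ c)
    (hK : M₂ - M₁ < K) (hk : 0 ≤ k) (hl : 0 ≤ l) (hkK : k * (r₂ ^ 2 - r₁ ^ 2) ^ 2 = K)
    (hlK : l * (T₁ - T₀) = K) :
    ∃ x₀ ∈ ball (0 : Eucl n) r₂, ∃ t₀ ∈ Ioc T₀ T, M₁ ≤ U x₀ t₀ ∧
      (∀ x ∈ ball (0 : Eucl n) r₂, U x t₀ ≤ U x₀ t₀ +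
        k * ((max (‖x₀‖ ^ 2 - r₁ ^ 2) 0 + (‖x‖ ^ 2 - ‖x₀‖ ^ 2)) ^ 2
          - max (‖x₀‖ ^ 2 - r₁ ^ 2) 0 ^ 2)) ∧
      ∀ t ∈ Icc T₀ t₀, U x₀ t ≤ U x₀ t₀ + l * (t₀ - t) := by
  have hr₂ : 0 < r₂ := hr₁.trans hr
  obtain ⟨⟨x₀, t₀⟩, ⟨hx₀, ht₀⟩, hmax⟩ :=
    ((isCompact_closedBall (0 : Eucl n) r₂).prod (isCompact_Icc (a := T₀) (b := T))).exists_isMaxOn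
      ⟨(0, T), by simp [hr₂.le, (hT₀.trans hT).le]⟩
      (hU.sub (f := fun q : Eucl n × ℝ => U q.1 q.2)
        (g := fun q => k * max (‖q.1‖ ^ 2 - r₁ ^ 2) 0 ^ 2 + l * max (T₁ - q.2) 0)
        (by fun_prop : Continuous _).continuousOn)
  replace hmax : ∀ x ∈ closedBall (0 : Eucl n) r₂, ∀ t ∈ Icc T₀ T,
      U x t - (k * max (‖x‖ ^ 2 - r₁ ^ 2) 0 ^ 2 + l * max (T₁ - t) 0) ≤
      U x₀ t₀ - (k * max (‖x₀‖ ^ 2 - r₁ ^ 2) 0 ^ 2 + l * max (T₁ - t₀) 0) :=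
    fun x hx t ht => hmax (a := (x, t)) ⟨hx, ht⟩
  simp only at hx₀ ht₀
  have hbig : M₁ ≤ U x₀ t₀ - (k * max (‖x₀‖ ^ 2 - r₁ ^ 2) 0 ^ 2 + l * max (T₁ - t₀) 0) := by
    refine hM₁ _ fun x hx t ht => ?_
    have hx' : ‖x‖ < r₁ := by simpa using hx
    have := hmax x (ball_subset_closedBall (ball_subset_ball hr.le hx)) t
      ⟨(hT₀.trans ht.1).le, ht.2.le⟩
    rw [max_eq_right (by nlinarith [norm_nonneg x]), max_eq_right (by linarith [ht.1])] at this
    simpa using this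
  have hle := hM₂ x₀ hx₀ t₀ ht₀
  have hw₁ : 0 ≤ k * max (‖x₀‖ ^ 2 - r₁ ^ 2) 0 ^ 2 := by positivity
  have hw₂ : 0 ≤ l * max (T₁ - t₀) 0 := by positivity
  have hx₀' : ‖x₀‖ ≤ r₂ := by simpa using hx₀
  have hx₀b : ‖x₀‖ < r₂ := by
    refine lt_of_le_of_ne hx₀' fun h => ?_
    rw [h, max_eq_left (by nlinarith : (0 : ℝ) ≤ r₂ ^ 2 - r₁ ^ 2), hkK] at hbig
    linarith
  have ht₀b : T₀ < t₀ := by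
    refine lt_of_le_of_ne ht₀.1 fun h => ?_
    rw [← h, max_eq_left (by linarith : (0 : ℝ) ≤ T₁ - T₀), hlK] at hbig
    rw [← h] at hle
    linarith
  refine ⟨x₀, by simpa using hx₀b, t₀, ⟨ht₀b, ht₀.2⟩, by linarith, fun x hx => ?_, fun t ht => ?_⟩
  · have h1 := hmax x (ball_subset_closedBall hx) t₀ ht₀
    have h2 := mul_le_mul_of_nonneg_left (sq_max_le (‖x‖ ^ 2 - r₁ ^ 2) (‖x₀‖ ^ 2 - r₁ ^ 2)) hk
    rw [sub_sub_sub_cancel_right] at h2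
    linarith
  · have h1 := hmax x₀ hx₀ t ⟨ht.1, ht.2.trans ht₀.2⟩
    have h2 : max (T₁ - t) 0 ≤ max (T₁ - t₀) 0 + (t₀ - t) :=
      max_le (by linarith [le_max_left (T₁ - t₀) 0]) (by linarith [le_max_right (T₁ - t₀) 0, ht.2])
    have h3 := mul_le_mul_of_nonneg_left h2 hl
    linarith

/-- A function decreasing at most at rate `l` up to `t₀` has derivative at least `-l` there. -/
lemma neg_le_deriv_of_le_left {φ : ℝ → ℝ} {d l t t₀ : ℝ} (ht : t < t₀) (hφ : HasDerivAt φ d t₀)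
    (hle : ∀ s ∈ Icc t t₀, φ s ≤ φ t₀ + l * (t₀ - s)) : -l ≤ d := by
  have h := (hasDerivAt_iff_tendsto_slope.mp hφ).mono_left
    (nhdsWithin_mono t₀ fun s (hs : s ∈ Iio t₀) => ne_of_lt hs)
  refine ge_of_tendsto h ?_
  filter_upwards [Ioo_mem_nhdsLT ht] with s hs
  rw [slope_def_field, le_div_iff_of_neg (by linarith [hs.2])]
  linarith [hle s ⟨hs.1.le, hs.2.le⟩]

/-- Upper bound for the contraction of `A` with the Hessian of the radial barrier. -/
lemma sum_mul_radial_hessian_le {n : ℕ} (A : Fin n → Fin n → ℝ) (x : Eucl n) {k σ B : ℝ}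
    (hk : 0 ≤ k) (hσ : 0 ≤ σ) (hB : k * (8 * ‖x‖ ^ 2 + 4 * σ) ≤ B) :
    ∑ i, ∑ j, A i j * (k * (8 * (x i * x j) + if i = j then 4 * σ else 0)) ≤
      B * ∑ i, ∑ j, |A i j| := by
  simp only [Finset.mul_sum]
  refine Finset.sum_le_sum fun i _ => Finset.sum_le_sum fun j _ => ?_
  have hx : |x i * x j| ≤ ‖x‖ ^ 2 := by
    rw [abs_mul, sq]
    exact mul_le_mul (PiLp.norm_apply_le x i) (PiLp.norm_apply_le x j) (abs_nonneg _)
      (norm_nonneg _)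
  have hH : |k * (8 * (x i * x j) + if i = j then 4 * σ else 0)| ≤ B := by
    rw [abs_mul, abs_of_nonneg hk]
    refine (mul_le_mul_of_nonneg_left ?_ hk).trans hB
    refine (abs_add_le _ _).trans (add_le_add ?_ ?_)
    · rw [abs_mul, abs_of_pos (by norm_num : (0 : ℝ) < 8)]
      linarith
    · split_ifs
      · rw [abs_of_nonneg (by linarith)]
      · simpa using hσ
  calc A i j * (k * (8 * (x i * x j) + if i = j then 4 * σ else 0))
      ≤ |A i j| * |k * (8 * (x i * x j) + if i = j then 4 * σ else 0)| :=
        (le_abs_self _).trans (abs_mul _ _).le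
    _ ≤ |A i j| * B := mul_le_mul_of_nonneg_left hH (abs_nonneg _)
    _ = B * |A i j| := mul_comm _ _

/-- The left limit of the lower envelope of a positive function is a lower bound above the
limit point. -/
lemma sSup_sInf_image_Icc_le {g : ℝ → ℝ} (hg : ∀ s, 0 < s → 0 < g s) {M₁ M₂ s : ℝ}
    (hM₁ : 0 < M₁) (h₁ : M₁ ≤ s) (h₂ : s ≤ M₂) :
    sSup ((fun μ => sInf (g '' Icc μ M₂)) '' Ioo 0 M₁) ≤ g s := by
  refine csSup_le ((nonempty_Ioo.mpr hM₁).image _) ?_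
  rintro _ ⟨μ, hμ, rfl⟩
  refine csInf_le ⟨0, ?_⟩ ⟨s, ⟨hμ.2.le.trans h₁, h₂⟩, rfl⟩
  rintro _ ⟨r, hr, rfl⟩
  exact (hg r (hμ.1.trans_le hr.1)).le

lemma sSup_sInf_image_Icc_nonneg {g : ℝ → ℝ} (hg : ∀ s, 0 < s → 0 < g s) (M₁ M₂ : ℝ) :
    0 ≤ sSup ((fun μ => sInf (g '' Icc μ M₂)) '' Ioo 0 M₁) := by
  refine Real.sSup_nonneg ?_
  rintro _ ⟨μ, hμ, rfl⟩
  refine Real.sInf_nonneg ?_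
  rintro _ ⟨r, hr, rfl⟩
  exact (hg r (hμ.1.trans_le hr.1)).le

/-- **Lemma 3.2.** There is a constant `C > 0` depending only on `n` such that for any
classical solution `u` of `∂u/∂t − Σ aᵢⱼ(x,u) ∂²u/∂xᵢ∂xⱼ + f(x,u,Du) ≤ 0` in
`ℝⁿ × (0,∞)` (under the structural assumptions) and any `0 < r₁ < r₂`,
`0 < τ₁ < τ₂ < τ` with `M₁ = sup_{Q_{r₁}^{τ−τ₁,τ}} u > 0`, at least one of the three
estimates below holds, where `M₂ = sup_{Q_{r₂}^{τ−τ₂,τ}} u`, `q(r) = inf_{B_r} p`, and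
`Lg, Lh` are the limits `lim_{μ→M₁−0} inf_{[μ,M₂]} g`, `lim_{μ→M₁−0} inf_{[μ,M₂]} h`
(expressed as suprema over `μ ∈ (0, M₁)` of the monotone quantities). -/
theorem lemma_3_2
    (n : ℕ) (hn : 1 ≤ n) :
    ∃ C : ℝ, 0 < C ∧
      ∀ (a : Eucl n → ℝ → Fin n → Fin n → ℝ)
        (f : Eucl n → ℝ → Eucl n → ℝ)
        (g h : ℝ → ℝ) (p : Eucl n → ℝ)
        (u : Eucl n → ℝ → ℝ) (du : Eucl n → ℝ → Eucl n)
        (d2u : Eucl n → ℝ → Fin n → Fin n → ℝ) (ut : Eucl n → ℝ → ℝ),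
        -- ellipticity
        (∀ (x : Eucl n) (ζ : ℝ), ζ ≠ 0 → ∀ ξ : Eucl n, ξ ≠ 0 →
          0 < ∑ i, ∑ j, a x ζ i j * ξ i * ξ j) →
        -- g, h : (0,∞) → (0,∞) measurable, locally bounded, positive inf on compacts
        Measurable g → Measurable h →
        (∀ s : ℝ, 0 < s → 0 < g s) → (∀ s : ℝ, 0 < s → 0 < h s) →
        (∀ K : Set ℝ, IsCompact K → K ⊆ Ioi 0 → BddAbove (g '' K)) →
        (∀ K : Set ℝ, IsCompact K → K ⊆ Ioi 0 → BddAbove (h '' K)) →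
        (∀ K : Set ℝ, IsCompact K → K ⊆ Ioi 0 → K.Nonempty → 0 < sInf (g '' K)) →
        (∀ K : Set ℝ, IsCompact K → K ⊆ Ioi 0 → K.Nonempty → 0 < sInf (h '' K)) →
        -- p : ℝⁿ → [0,∞) measurable and locally bounded
        Measurable p → (∀ x, 0 ≤ p x) →
        (∀ K : Set (Eucl n), IsCompact K → BddAbove (p '' K)) →
        -- the structural condition (1.2)
        (∀ (x : Eucl n) (ζ : ℝ), ζ ≠ 0 → ∀ lam : ℝ, 0 ≤ lam → lam ≤ p x * h |ζ| →
          p x * g |ζ| * (1 + ∑ i, ∑ j, |a x ζ i j|) ≤ f x ζ (lam • x) * Real.sign ζ) →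
        -- `u` is a classical solution of the differential inequality
        (∀ (x : Eucl n) (t : ℝ), 0 < t → ∀ i,
          HasDerivAt (fun s : ℝ => u (x + s • EuclideanSpace.single i (1 : ℝ)) t)
            (du x t i) 0) →
        (∀ (x : Eucl n) (t : ℝ), 0 < t → ∀ i j,
          HasDerivAt (fun s : ℝ => du (x + s • EuclideanSpace.single j (1 : ℝ)) t i)
            (d2u x t i j) 0) →
        (∀ (x : Eucl n) (t : ℝ), 0 < t → HasDerivAt (fun τ : ℝ => u x τ) (ut x t) t) →
        ContinuousOn (fun q : Eucl n × ℝ => u q.1 q.2) (univ ×ˢ Ioi 0) →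
        (∀ i, ContinuousOn (fun q : Eucl n × ℝ => du q.1 q.2 i) (univ ×ˢ Ioi 0)) →
        (∀ i j, ContinuousOn (fun q : Eucl n × ℝ => d2u q.1 q.2 i j) (univ ×ˢ Ioi 0)) →
        ContinuousOn (fun q : Eucl n × ℝ => ut q.1 q.2) (univ ×ˢ Ioi 0) →
        (∀ (x : Eucl n) (t : ℝ), 0 < t →
          ut x t - (∑ i, ∑ j, a x (u x t) i j * d2u x t i j) + f x (u x t) (du x t) ≤ 0) →
        -- the radii, times, suprema and limits
        ∀ r₁ r₂ τ₁ τ₂ τ M₁ M₂ Q Lg Lh : ℝ,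
          0 < r₁ → r₁ < r₂ → 0 < τ₁ → τ₁ < τ₂ → τ₂ < τ →
          M₁ = sSup ((fun q : Eucl n × ℝ => u q.1 q.2) ''
            (ball (0 : Eucl n) r₁ ×ˢ Ioo (τ - τ₁) τ)) →
          M₂ = sSup ((fun q : Eucl n × ℝ => u q.1 q.2) ''
            (ball (0 : Eucl n) r₂ ×ˢ Ioo (τ - τ₂) τ)) →
          0 < M₁ →
          Q = sInf (p '' ball (0 : Eucl n) r₂) →
          Lg = sSup ((fun μ => sInf (g '' Icc μ M₂)) '' Ioo 0 M₁) →
          Lh = sSup ((fun μ => sInf (h '' Icc μ M₂)) '' Ioo 0 M₁) →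
          (C * (r₂ - r₁) ^ 2 * Q * Lg ≤ M₂ - M₁ ∨
           C * (r₂ - r₁) * r₂ * Q * Lh ≤ M₂ - M₁ ∨
           C * (τ₂ - τ₁) * Q * Lg ≤ M₂ - M₁) := by
  refine ⟨1 / 12, by norm_num, ?_⟩
  intro a f g h p u du d2u ut hell _ _ hg hh _ _ _ _ _ hp _ hstruct hdu hd2u hut cu cdu cd2u _
    hineq r₁ r₂ τ₁ τ₂ τ M₁ M₂ Q Lg Lh hr₁ hr hτ₁ hτ₁₂ hτ hM₁ hM₂ hM₁pos hQ hLg hLh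
  by_contra! hcon
  obtain ⟨hc1, hc2, hc3⟩ := hcon
  have hr₂ : 0 < r₂ := hr₁.trans hr
  have hslice : ∀ {F : Eucl n × ℝ → ℝ}, ContinuousOn F (univ ×ˢ Ioi 0) → ∀ t : ℝ, 0 < t →
      Continuous fun x => F (x, t) := fun hF t ht =>
    hF.comp_continuous (by fun_prop) fun x => ⟨mem_univ _, ht⟩
  have hcyl : closedBall (0 : Eucl n) r₂ ×ˢ Icc (τ - τ₂) τ ⊆ univ ×ˢ Ioi 0 :=
    prod_mono (subset_univ _) fun t ht => lt_of_lt_of_le (by linarith : 0 < τ - τ₂) ht.1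
  have cU := cu.mono hcyl
  have hbdd : BddAbove ((fun q : Eucl n × ℝ => u q.1 q.2) ''
      (closedBall (0 : Eucl n) r₂ ×ˢ Icc (τ - τ₂) τ)) :=
    ((isCompact_closedBall _ _).prod isCompact_Icc).bddAbove_image cU
  have hle₂ : ∀ q ∈ ball (0 : Eucl n) r₂ ×ˢ Ioo (τ - τ₂) τ, u q.1 q.2 ≤ M₂ := fun q hq => by
    rw [hM₂]
    exact le_csSup (hbdd.mono (image_mono (prod_mono ball_subset_closedBall Ioo_subset_Icc_self)))
      ⟨q, hq, rfl⟩
  have hclosure : closure (ball (0 : Eucl n) r₂ ×ˢ Ioo (τ - τ₂) τ) =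
      closedBall (0 : Eucl n) r₂ ×ˢ Icc (τ - τ₂) τ := by
    rw [closure_prod_eq, closure_ball _ hr₂.ne', closure_Ioo (by linarith)]
  have hle₂' : ∀ x ∈ closedBall (0 : Eucl n) r₂, ∀ t ∈ Icc (τ - τ₂) τ, u x t ≤ M₂ := by
    intro x hx t ht
    rw [← hclosure] at cU
    exact le_on_closure hle₂ cU continuousOn_const (hclosure ▸ mk_mem_prod hx ht)
  have hne₁ : ((fun q : Eucl n × ℝ => u q.1 q.2) ''
      (ball (0 : Eucl n) r₁ ×ˢ Ioo (τ - τ₁) τ)).Nonempty :=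
    ((nonempty_ball.mpr hr₁).prod (nonempty_Ioo.mpr (by linarith))).image _
  have hle₁ : ∀ c, (∀ x ∈ ball (0 : Eucl n) r₁, ∀ t ∈ Ioo (τ - τ₁) τ, u x t ≤ c) → M₁ ≤ c := by
    intro c hc
    rw [hM₁]
    refine csSup_le hne₁ ?_
    rintro _ ⟨⟨x, t⟩, ⟨hx, ht⟩, rfl⟩
    exact hc x hx t ht
  have hM₁₂ : M₁ ≤ M₂ := hle₁ _ fun x hx t ht =>
    hle₂ (x, t) ⟨ball_subset_ball hr.le hx, by linarith [ht.1], ht.2⟩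
  obtain ⟨K, hK, hKlt⟩ := exists_between (lt_min hc1 (lt_min hc2 hc3))
  obtain ⟨hK1, hK2, hK3⟩ : _ ∧ _ ∧ _ := by simpa only [lt_min_iff] using hKlt
  have hKpos : 0 < K := by linarith
  have hR : 0 < r₂ ^ 2 - r₁ ^ 2 := sub_pos.mpr (pow_lt_pow_left₀ hr hr₁.le two_ne_zero)
  obtain ⟨k, hkK⟩ : ∃ k, k * (r₂ ^ 2 - r₁ ^ 2) ^ 2 = K := ⟨_, div_mul_cancel₀ K (by positivity)⟩
  obtain ⟨l, hlK⟩ : ∃ l, l * ((τ - τ₁) - (τ - τ₂)) = K := ⟨_, div_mul_cancel₀ K (by linarith)⟩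
  have hk : 0 < k := pos_of_mul_pos_left (hkK ▸ hKpos) (by positivity)
  have hl : 0 < l := pos_of_mul_pos_left (hlK ▸ hKpos) (by linarith)
  obtain ⟨x₀, hx₀, t₀, ht₀, hM₁u, hspace, htime⟩ := exists_touching_point cU hr₁ hr
    (by linarith) (by linarith) hle₂' hle₁ hK hk.le hl.le hkK hlK
  set σ := max (‖x₀‖ ^ 2 - r₁ ^ 2) 0 with hσ
  have ht₀pos : 0 < t₀ := by linarith [ht₀.1]
  have hupos : 0 < u x₀ t₀ := hM₁pos.trans_le hM₁u
  have huM₂ : u x₀ t₀ ≤ M₂ := hle₂' x₀ (ball_subset_closedBall hx₀) t₀ ⟨ht₀.1.le, ht₀.2⟩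
  have hx₀' : ‖x₀‖ < r₂ := by simpa using hx₀
  have hx₀sq : ‖x₀‖ ^ 2 ≤ r₂ ^ 2 := pow_le_pow_left₀ (norm_nonneg _) hx₀'.le 2
  have hσ0 : 0 ≤ σ := le_max_right _ _
  have hσR : σ ≤ r₂ ^ 2 - r₁ ^ 2 := max_le (by linarith) hR.le
  have hA : ∀ ξ : Fin n → ℝ, 0 ≤ ∑ i, ∑ j, a x₀ (u x₀ t₀) i j * ξ i * ξ j := by
    intro ξ
    rcases eq_or_ne ξ 0 with rfl | hξ
    · simp
    · exact (hell x₀ _ hupos.ne' (WithLp.toLp 2 ξ) (by simpa using hξ)).le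
  obtain ⟨hgrad, hhess⟩ := conditions_of_touching_radial (v := fun x => u x t₀)
    (dv := fun x => du x t₀) (d2v := fun x => d2u x t₀) (fun x i => hdu x t₀ ht₀pos i)
    (fun x i j => hd2u x t₀ ht₀pos i j) (fun i => hslice (cdu i) t₀ ht₀pos)
    (fun i j => hslice (cd2u i j) t₀ ht₀pos)
    (Filter.eventually_of_mem (isOpen_ball.mem_nhds hx₀) hspace) hA
  have htd := neg_le_deriv_of_le_left ht₀.1 (hut x₀ t₀ ht₀pos) htime
  have hQp : Q ≤ p x₀ := by
    rw [hQ]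
    refine csInf_le ⟨0, ?_⟩ ⟨x₀, hx₀, rfl⟩
    rintro _ ⟨y, -, rfl⟩
    exact hp y
  have hQ0 : 0 ≤ Q := by
    rw [hQ]
    refine Real.sInf_nonneg ?_
    rintro _ ⟨y, -, rfl⟩
    exact hp y
  have hg₀ : Q * Lg ≤ p x₀ * g (u x₀ t₀) :=
    mul_le_mul hQp (hLg ▸ sSup_sInf_image_Icc_le hg hM₁pos hM₁u huM₂)
      (hLg ▸ sSup_sInf_image_Icc_nonneg hg M₁ M₂) (hp x₀)
  have hh₀ : Q * Lh ≤ p x₀ * h (u x₀ t₀) :=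
    mul_le_mul hQp (hLh ▸ sSup_sInf_image_Icc_le hh hM₁pos hM₁u huM₂)
      (hLh ▸ sSup_sInf_image_Icc_nonneg hh M₁ M₂) (hp x₀)
  have hd : 0 < r₂ - r₁ := by linarith
  have hRd : (r₂ - r₁) * r₂ ≤ r₂ ^ 2 - r₁ ^ 2 := by nlinarith only [mul_pos hd hr₁]
  have hlam : 4 * k * σ ≤ p x₀ * h |u x₀ t₀| := by
    rw [abs_of_pos hupos]
    refine le_trans ?_ hh₀
    refine le_of_mul_le_mul_right ?_ (mul_pos hd hr₂)
    have h1 : k * σ * ((r₂ - r₁) * r₂) ≤ k * (r₂ ^ 2 - r₁ ^ 2) * (r₂ ^ 2 - r₁ ^ 2) := by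
      gcongr
    linarith
  have hs := hstruct x₀ (u x₀ t₀) hupos.ne' (4 * k * σ) (by positivity) hlam
  rw [abs_of_pos hupos, Real.sign_of_pos hupos, mul_one, ← hgrad] at hs
  have hG : 12 * k * r₂ ^ 2 < Q * Lg := by
    refine lt_of_mul_lt_mul_right ?_ (sq_nonneg (r₂ - r₁))
    have h1 : k * ((r₂ - r₁) * r₂) ^ 2 ≤ k * (r₂ ^ 2 - r₁ ^ 2) ^ 2 := by gcongr
    linarith
  have hT : l < Q * Lg := by
    refine lt_of_mul_lt_mul_right ?_ (by linarith : 0 ≤ τ₂ - τ₁)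
    linarith
  have hB : k * (8 * ‖x₀‖ ^ 2 + 4 * σ) ≤ Q * Lg := by
    refine le_trans (mul_le_mul_of_nonneg_left ?_ hk.le) (by linarith : k * (12 * r₂ ^ 2) ≤ Q * Lg)
    linarith only [hx₀sq, hσR, sq_nonneg r₁]
  have hsum := sum_mul_radial_hessian_le (a x₀ (u x₀ t₀)) x₀ hk.le hσ0 hB
  have hA0 : 0 ≤ ∑ i, ∑ j, |a x₀ (u x₀ t₀) i j| :=
    Finset.sum_nonneg fun i _ => Finset.sum_nonneg fun j _ => abs_nonneg _
  have hpg := mul_le_mul_of_nonneg_right hg₀ (by linarith : 0 ≤ 1 + ∑ i, ∑ j, |a x₀ (u x₀ t₀) i j|)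
  have := hineq x₀ t₀ ht₀pos
  linarith
end
end
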